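/- Let X be a C³ smooth submanifold of codimension 1 in ℝ^d, let x₀ ∈ X, and let ξ₀ ∈ T_{x₀}X with ‖ξ₀‖ = 1 be such that the normal curvature of X at x₀ in the direction ξ₀ is non-zero. Then for every ε > 0 there exist an open neighbourhood V of x₀ in X, a smooth map V ∋ x ↦ ξ(x) ∈ T_xX with ‖ξ(x)‖ = 1 and ξ(x₀) = ξ₀, and a smooth function t : V → [δ, ε] for some δ > 0, such that Y = {y(x) = x + t(x)ξ(x) : x ∈ V} is a smooth strictly convex hypersurface whose unit normal field satisfies ν_Y(y(x)) = ξ(x) for all x ∈ V; that is, for each x ∈ V the straight line through y(x) in direction ξ(x) is orthogonal to Y at y(x) and tangent to X at x. -/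

import Mathlib

open MeasureTheory Metric Set Bornology
open scoped ENNReal RealInnerProductSpace

noncomputable section

/-- Euclidean space `ℝ^d`. -/
abbrev Euc (d : ℕ) : Type := EuclideanSpace ℝ (Fin d)

/-- A compact strictly convex domain with nonempty interior and `C³` smooth boundary,
described by a global `C³` defining function with nonvanishing gradient on the boundary. -/
def IsStrictlyConvexBodyC3 {d : ℕ} (B : Set (Euc d)) : Prop :=
  IsCompact B ∧ (interior B).Nonempty ∧ StrictConvex ℝ B ∧
    ∃ f : Euc d → ℝ, ContDiff ℝ 3 f ∧ B = {x | f x ≤ 0} ∧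
      ∀ x ∈ frontier B, f x = 0 ∧ fderiv ℝ f x ≠ 0

/-- An obstacle: a finite disjoint union of strictly convex compact domains with
`C³` boundaries. -/
def IsObstacle {d : ℕ} (K : Set (Euc d)) : Prop :=
  ∃ (k : ℕ) (B : Fin k → Set (Euc d)), 0 < k ∧
    (∀ i, IsStrictlyConvexBodyC3 (B i)) ∧
    (∀ i j, i ≠ j → Disjoint (B i) (B j)) ∧ K = ⋃ i, B i

/-- `ν` is the outward unit normal field on `∂K`: at every boundary point it is a unit
vector supporting (the local component of) `K` from outside. -/
def IsOutwardNormal {d : ℕ} (K : Set (Euc d)) (ν : Euc d → Euc d) : Prop :=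
  ∀ p ∈ frontier K, ‖ν p‖ = 1 ∧ ∃ δ > 0, ∀ q ∈ K ∩ ball p δ, ⟪ν p, q - p⟫ ≤ 0

/-- Billiard reflection of the direction `v` with respect to the unit normal `n`:
`v ↦ v - 2⟨v,n⟩n`. -/
def reflectDir {d : ℕ} (n v : Euc d) : Euc d := v - (2 * ⟪v, n⟫) • n

/-- The unit sphere bundle `S*(Ω_K)` of `Ω_K = closure (ℝ^d ∖ K)`, realized as a subset
of `ℝ^d × ℝ^d`. -/
def SStar {d : ℕ} (K : Set (Euc d)) : Set (Euc d × Euc d) :=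
  {x | x.1 ∈ closure Kᶜ ∧ ‖x.2‖ = 1}

/-- `F` is the billiard flow in the exterior of the obstacle `K` (with outward unit normal
field `ν` on `∂K`): it is a one-parameter group, it preserves `S*(Ω_K)`, points move along
straight lines away from `∂K`, and at a boundary point the incoming direction `w` is
reflected to `w - 2⟨w,ν⟩ν` if the hit is transversal, while tangential hits (`⟨w,ν⟩ = 0`)
continue along the same straight line. -/
def IsBilliardFlow {d : ℕ} (K : Set (Euc d)) (ν : Euc d → Euc d)
    (F : ℝ → Euc d × Euc d → Euc d × Euc d) : Prop :=
  (∀ x, F 0 x = x) ∧ (∀ s t x, F (s + t) x = F s (F t x)) ∧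
  ∀ x ∈ SStar K, ∀ t : ℝ,
    F t x ∈ SStar K ∧
    ((F t x).1 ∉ frontier K →
      ∃ ε > 0, ∀ s : ℝ, |s| < ε →
        F (t + s) x = ((F t x).1 + s • (F t x).2, (F t x).2)) ∧
    ((F t x).1 ∈ frontier K →
      ∃ w : Euc d, ‖w‖ = 1 ∧ ⟪w, ν ((F t x).1)⟫ ≤ 0 ∧
        (F t x).2 = reflectDir (ν ((F t x).1)) w ∧
        ∃ ε > 0,
          (∀ s : ℝ, -ε < s → s < 0 → F (t + s) x = ((F t x).1 + s • w, w)) ∧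
          (∀ s : ℝ, 0 < s → s < ε →
            F (t + s) x = ((F t x).1 + s • (F t x).2, (F t x).2)))

/-- The forward trajectory `γ_K⁺(x) = {pr₁(F_t(x)) : t ≥ 0}`. -/
def fwdTraj {d : ℕ} (F : ℝ → Euc d × Euc d → Euc d × Euc d) (x : Euc d × Euc d) :
    Set (Euc d) := {p | ∃ t : ℝ, 0 ≤ t ∧ (F t x).1 = p}

/-- A phase point is trapped if its forward or its backward trajectory is bounded. -/
def IsTrapped {d : ℕ} (F : ℝ → Euc d × Euc d → Euc d × Euc d) (x : Euc d × Euc d) : Prop :=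
  IsBounded (fwdTraj F x) ∨ IsBounded (fwdTraj F (x.1, -x.2))

/-- The set `Trap(Ω_K)` of trapped points of `S*(Ω_K)`. -/
def TrapSet {d : ℕ} (K : Set (Euc d)) (F : ℝ → Euc d × Euc d → Euc d × Euc d) :
    Set (Euc d × Euc d) := {x ∈ SStar K | IsTrapped F x}

/-- The travelling time of `x` inside `M`: the maximal `T ∈ [0,∞]` such that
`pr₁(F_t(x))` stays in the interior of `Ω_K ∩ M` for all `0 < t < T`. -/
def travelTime {d : ℕ} (F : ℝ → Euc d × Euc d → Euc d × Euc d)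
    (K M : Set (Euc d)) (x : Euc d × Euc d) : ℝ≥0∞ :=
  sSup {T : ℝ≥0∞ | ∀ t : ℝ, 0 < t → ENNReal.ofReal t < T →
    (F t x).1 ∈ interior (closure Kᶜ ∩ M)}

/-- `S*₊(S₀)`: pairs `(q,v)` with `q` on the sphere `S₀ = ∂B(c,a)`, `v` a unit vector with
`⟨v, ν(q)⟩ ≥ 0`, where `ν(q) = a⁻¹ • (c - q)` is the inward unit normal to `S₀`. -/
def SPlus {d : ℕ} (c : Euc d) (a : ℝ) : Set (Euc d × Euc d) :=
  {x | x.1 ∈ sphere c a ∧ ‖x.2‖ = 1 ∧ 0 ≤ ⟪x.2, a⁻¹ • (c - x.1)⟫}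

/-- `S` is an `m`-dimensional `C^k` submanifold of the normed space `E`: locally it is the
regular zero set of a `C^k` map into `ℝ^{dim E - m}` with surjective differential. -/
def IsSubmanifold {E : Type*} [NormedAddCommGroup E] [NormedSpace ℝ E]
    (k : ℕ∞) (m : ℕ) (S : Set E) : Prop :=
  ∀ p ∈ S, ∃ (U : Set E) (f : E → EuclideanSpace ℝ (Fin (Module.finrank ℝ E - m))),
    IsOpen U ∧ p ∈ U ∧ ContDiffOn ℝ k f U ∧ S ∩ U = {x ∈ U | f x = 0} ∧
    ∀ x ∈ S ∩ U, Function.Surjective (fderiv ℝ f x)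

/-- The trajectory of `x` is a simply reflecting ray: unbounded in both directions, with
finitely many common points with `∂K`, all of them transversal reflection points
(the outgoing direction makes a positive inner product with the outward normal),
and no tangencies to `∂K`. -/
def SimplyReflecting {d : ℕ} (K : Set (Euc d)) (ν : Euc d → Euc d)
    (F : ℝ → Euc d × Euc d → Euc d × Euc d) (x : Euc d × Euc d) : Prop :=
  ¬ IsBounded (fwdTraj F x) ∧ ¬ IsBounded (fwdTraj F (x.1, -x.2)) ∧
  {t : ℝ | (F t x).1 ∈ frontier K}.Finite ∧
  ∀ t : ℝ, (F t x).1 ∈ frontier K → 0 < ⟪(F t x).2, ν ((F t x).1)⟫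

/-- The set of points of tangency of the complete trajectory `γ_K(x)` to `∂K`. -/
def tangencyPoints {d : ℕ} (K : Set (Euc d)) (ν : Euc d → Euc d)
    (F : ℝ → Euc d × Euc d → Euc d × Euc d) (x : Euc d × Euc d) : Set (Euc d) :=
  {p | p ∈ frontier K ∧ ∃ t : ℝ, (F t x).1 = p ∧ ⟪(F t x).2, ν p⟫ = 0}

/-- The spherical Lebesgue measure on the unit sphere of `ℝ^d`. -/
def sphMeasure (d : ℕ) : Measure (sphere (0 : Euc d) 1) :=
  (volume : Measure (Euc d)).toSphere

section Helpers

open Filter Topology unitInterval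

section Nemytskii

variable {K : Type*} [TopologicalSpace K] [CompactSpace K]
  {E : Type*} [NormedAddCommGroup E] [NormedSpace ℝ E]
  {G : Type*} [NormedAddCommGroup G] [NormedSpace ℝ G]

/-- Pointwise application of a continuous family of linear maps to a continuous map. -/
def pointwiseApply : C(K, E →L[ℝ] G) →L[ℝ] C(K, E) →L[ℝ] C(K, G) :=
  LinearMap.mkContinuous₂
    (LinearMap.mk₂ ℝ (fun (A : C(K, E →L[ℝ] G)) (γ : C(K, E)) =>
        (⟨fun s => A s (γ s), A.continuous.clm_apply γ.continuous⟩ : C(K, G)))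
      (fun A B γ => by ext; simp) (fun c A γ => by ext; simp)
      (fun A γ η => by ext; simp) (fun c A γ => by ext; simp)) 1
    (fun A γ => by
      rw [one_mul, ContinuousMap.norm_le _ (by positivity)]
      intro s
      exact (ContinuousLinearMap.le_opNorm _ _).trans
        (by gcongr; exacts [A.norm_coe_le_norm s, γ.norm_coe_le_norm s]))

@[simp] lemma pointwiseApply_apply (A : C(K, E →L[ℝ] G)) (γ : C(K, E)) (s : K) :
    pointwiseApply A γ s = A s (γ s) := rfl

lemma hasFDerivAt_postcomp {F : E → G} (hF : ContDiff ℝ 1 F) (γ : C(K, E)) :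
    HasFDerivAt (fun γ : C(K, E) => (⟨F, hF.continuous⟩ : C(E, G)).comp γ)
      (pointwiseApply ((⟨fderiv ℝ F, hF.continuous_fderiv one_ne_zero⟩ : C(E, E →L[ℝ] G)).comp γ))
      γ := by
  have hc : Continuous (fderiv ℝ F) := hF.continuous_fderiv one_ne_zero
  have hd : Differentiable ℝ F := hF.differentiable one_ne_zero
  rw [hasFDerivAt_iff_isLittleO, Asymptotics.isLittleO_iff]
  intro ε hε
  have hcomp : IsCompact (range γ) := isCompact_range γ.continuous
  have hδ : ∃ δ > 0, ∀ x ∈ range γ, ∀ y, dist x y < δ →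
      dist (fderiv ℝ F x) (fderiv ℝ F y) < ε := by
    have := hcomp.uniformContinuousAt_of_continuousAt (fderiv ℝ F)
      (fun x _ => hc.continuousAt) (Metric.dist_mem_uniformity hε)
    obtain ⟨δ, hδ, h⟩ := Metric.mem_uniformity_dist.1 this
    exact ⟨δ, hδ, fun x hx y hxy => h hxy hx⟩
  obtain ⟨δ, hδ, h⟩ := hδ
  filter_upwards [Metric.ball_mem_nhds γ hδ] with η hη
  rw [ContinuousMap.norm_le _ (by positivity)]
  intro s
  have hs : ‖η s - γ s‖ < δ := by
    rw [← dist_eq_norm]; exact (ContinuousMap.dist_apply_le_dist s).trans_lt hη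
  have := (convex_ball (γ s) δ).norm_image_sub_le_of_norm_hasFDerivWithin_le'
    (f := F) (f' := fderiv ℝ F) (φ := fderiv ℝ F (γ s)) (C := ε) (x := γ s) (y := η s)
    (fun x _ => (hd x).hasFDerivAt.hasFDerivWithinAt)
    (fun x hx => by
      rw [← dist_eq_norm, dist_comm]
      exact (h (γ s) (mem_range_self s) x (by rwa [dist_comm])).le)
    (mem_ball_self hδ) (by rwa [mem_ball, dist_eq_norm])
  refine this.trans ?_
  gcongr
  exact (η - γ).norm_coe_le_norm s

lemma contDiff_postcomp {F : E → G} (hF : ContDiff ℝ 1 F) :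
    ContDiff ℝ 1 (fun γ : C(K, E) => (⟨F, hF.continuous⟩ : C(E, G)).comp γ) := by
  rw [contDiff_one_iff_hasFDerivAt]
  refine ⟨_, ?_, hasFDerivAt_postcomp hF⟩
  exact pointwiseApply.continuous.comp (ContinuousMap.continuous_postcomp _)

end Nemytskii

section Primitive

variable {E : Type*} [NormedAddCommGroup E] [NormedSpace ℝ E]

/-- The primitive vanishing at `0` of a continuous curve on the unit interval. -/
def primitive : C(I, E) →L[ℝ] C(I, E) :=
  LinearMap.mkContinuous
    { toFun := fun γ => ⟨fun s => ∫ r in (0 : ℝ)..s, γ (projIcc 0 1 zero_le_one r), by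
        have : Continuous fun r => γ (projIcc 0 1 zero_le_one r) :=
          γ.continuous.comp continuous_projIcc
        exact (intervalIntegral.continuous_primitive
          (fun a b => this.intervalIntegrable a b) 0).comp continuous_subtype_val⟩
      map_add' := fun γ η => by
        ext s
        exact intervalIntegral.integral_add
          ((γ.continuous.comp continuous_projIcc).intervalIntegrable _ _)
          ((η.continuous.comp continuous_projIcc).intervalIntegrable _ _)
      map_smul' := fun c γ => by
        ext s
        exact intervalIntegral.integral_smul _ _ } 1
    (fun γ => by
      rw [one_mul, ContinuousMap.norm_le _ (by positivity)]
      intro s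
      refine (intervalIntegral.norm_integral_le_of_norm_le_const (C := ‖γ‖)
        (fun r _ => γ.norm_coe_le_norm _)).trans ?_
      rw [sub_zero, abs_of_nonneg s.2.1]
      exact mul_le_of_le_one_right (norm_nonneg _) s.2.2)

end Primitive

section Flow

variable {E : Type*} [NormedAddCommGroup E] [NormedSpace ℝ E]

/-- The constant curve, as a continuous linear map of its value. -/
def constCurve : E →L[ℝ] C(I, E) :=
  LinearMap.mkContinuous
    { toFun := fun y => ContinuousMap.const I y
      map_add' := fun _ _ => rfl
      map_smul' := fun _ _ => rfl } 1
    (fun y => by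
      rw [one_mul, ContinuousMap.norm_le _ (by positivity)]
      intro s
      rfl)

@[simp] lemma constCurve_apply (y : E) (s : I) : constCurve y s = y := rfl

lemma exists_contDiffAt_solution [CompleteSpace E] {F : E → E} (hF : ContDiff ℝ 1 F) (y₀ : E) :
    ∃ Γ : ℝ × E → C(I, E), ContDiffAt ℝ 1 Γ (0, y₀) ∧ Γ (0, y₀) = constCurve y₀ ∧
      ∀ᶠ q in 𝓝 ((0 : ℝ), y₀), Γ q =
        constCurve q.2 + q.1 • primitive ((⟨F, hF.continuous⟩ : C(E, E)).comp (Γ q)) := by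
  let G : (ℝ × E) × C(I, E) → C(I, E) := fun p =>
    p.2 - constCurve p.1.2 - p.1.1 • primitive ((⟨F, hF.continuous⟩ : C(E, E)).comp p.2)
  have hN : ContDiff ℝ 1 (fun p : (ℝ × E) × C(I, E) =>
      primitive ((⟨F, hF.continuous⟩ : C(E, E)).comp p.2)) :=
    primitive.contDiff.comp ((contDiff_postcomp hF).comp contDiff_snd)
  have hG : ContDiff ℝ 1 G := by
    refine (contDiff_snd.sub ((constCurve (E := E)).contDiff.comp (contDiff_snd.comp contDiff_fst))).sub ?_
    exact (contDiff_fst.comp contDiff_fst).smul hN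
  have hGat := hG.contDiffAt (x := (((0 : ℝ), y₀), constCurve y₀))
  have hinv : fderiv ℝ G ((0, y₀), constCurve y₀) ∘L .inr ℝ (ℝ × E) C(I, E) =
      ContinuousLinearMap.id ℝ _ := by
    have h1 : HasFDerivAt (fun γ : C(I, E) => G ((0, y₀), γ))
        (fderiv ℝ G ((0, y₀), constCurve y₀) ∘L .inr ℝ (ℝ × E) C(I, E)) (constCurve y₀) :=
      (hGat.differentiableAt one_ne_zero).hasFDerivAt.comp (constCurve y₀)
        (hasFDerivAt_prodMk_right _ _)
    have h2 : HasFDerivAt (fun γ : C(I, E) => G ((0, y₀), γ))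
        (ContinuousLinearMap.id ℝ C(I, E)) (constCurve y₀) := by
      have : (fun γ : C(I, E) => G ((0, y₀), γ)) = fun γ => γ - constCurve y₀ := by
        ext γ; simp [G]
      rw [this]
      exact (hasFDerivAt_id _).sub_const _
    exact h1.unique h2
  have hinv' : (fderiv ℝ G ((0, y₀), constCurve y₀) ∘L .inr ℝ (ℝ × E) C(I, E)).IsInvertible := by
    rw [hinv]
    exact ⟨ContinuousLinearEquiv.refl ℝ _, rfl⟩
  refine ⟨hGat.implicitFunction one_ne_zero hinv',
    hGat.contDiffAt_implicitFunction one_ne_zero hinv',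
    hGat.implicitFunction_apply_self one_ne_zero hinv', ?_⟩
  filter_upwards [hGat.eventually_apply_implicitFunction one_ne_zero hinv'] with q hq
  have h0 : G ((0, y₀), constCurve y₀) = 0 := by simp [G]
  rw [h0] at hq
  have := sub_eq_zero.1 hq
  rw [← this]
  abel

lemma hasDerivAt_integral_projIcc [CompleteSpace E] (g : C(I, E)) (s : ℝ) :
    HasDerivAt (fun s => ∫ r in (0 : ℝ)..s, g (projIcc 0 1 zero_le_one r))
      (g (projIcc 0 1 zero_le_one s)) s := by
  have hc : Continuous fun r => g (projIcc 0 1 zero_le_one r) :=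
    g.continuous.comp continuous_projIcc
  exact intervalIntegral.integral_hasDerivAt_right (hc.intervalIntegrable _ _)
    (hc.stronglyMeasurableAtFilter _ _) hc.continuousAt

/-- A curve which equals `y + λ ∫ g` extends to a differentiable function on the real line. -/
lemma exists_hasDerivAt_of_eq_primitive [CompleteSpace E] {z g : C(I, E)} {y : E} {c : ℝ}
    (h : z = constCurve y + c • primitive g) :
    ∃ u : ℝ → E, u 0 = y ∧ (∀ s : I, u s = z s) ∧
      ∀ s, HasDerivAt u (c • g (projIcc 0 1 zero_le_one s)) s := by
  refine ⟨fun s => y + c • ∫ r in (0 : ℝ)..s, g (projIcc 0 1 zero_le_one r), by simp, ?_, ?_⟩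
  · intro s
    rw [h]
    rfl
  · intro s
    exact ((hasDerivAt_integral_projIcc g s).const_smul c).const_add y

/-- Uniqueness for affine differential equations on the unit interval. -/
lemma eq_of_hasDerivAt_affine {A : C(I, E →L[ℝ] E)} {b : C(I, E)} {u w : ℝ → E}
    (hu : ∀ s : I, HasDerivAt u (b s + A s (u s)) s)
    (hw : ∀ s : I, HasDerivAt w (b s + A s (w s)) s) (h0 : u 0 = w 0) (s : I) :
    u s = w s := by
  have hv : ∀ t ∈ Ico (0 : ℝ) 1, LipschitzOnWith ‖A‖₊
      (fun x => b (projIcc 0 1 zero_le_one t) + A (projIcc 0 1 zero_le_one t) x) univ := by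
    intro t _
    refine LipschitzOnWith.of_dist_le_mul fun x _ y _ => ?_
    rw [dist_add_left, dist_eq_norm, dist_eq_norm, ← map_sub]
    refine (ContinuousLinearMap.le_opNorm _ _).trans ?_
    gcongr
    exact A.norm_coe_le_norm _
  have key : ∀ u : ℝ → E, (∀ s : I, HasDerivAt u (b s + A s (u s)) s) →
      ContinuousOn u (Icc 0 1) ∧ ∀ t ∈ Ico (0 : ℝ) 1, HasDerivWithinAt u
        (b (projIcc 0 1 zero_le_one t) + A (projIcc 0 1 zero_le_one t) (u t)) (Ici t) t := by
    intro u hu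
    refine ⟨fun t ht => (hu ⟨t, ht⟩).continuousAt.continuousWithinAt, fun t ht => ?_⟩
    rw [projIcc_of_mem zero_le_one (Ico_subset_Icc_self ht)]
    exact (hu ⟨t, Ico_subset_Icc_self ht⟩).hasDerivWithinAt
  exact ODE_solution_unique_of_mem_Icc_right (s := fun _ => univ) hv (key u hu).1 (key u hu).2
    (fun _ _ => mem_univ _) (key w hw).1 (key w hw).2 (fun _ _ => mem_univ _) h0 s.2

lemma eventually_forall_curve {X : Type*} [TopologicalSpace X] {γ : X → C(I, E)} {q₀ : X} {y₀ : E}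
    (hγ : ContinuousAt γ q₀) (h₀ : γ q₀ = constCurve y₀) {P : E → Prop} (hP : ∀ᶠ y in 𝓝 y₀, P y) :
    ∀ᶠ q in 𝓝 q₀, ∀ s, P (γ q s) := by
  obtain ⟨r, hr, h⟩ := Metric.eventually_nhds_iff.1 hP
  filter_upwards [hγ (Metric.ball_mem_nhds _ hr)] with q hq s
  rw [h₀] at hq
  exact h ((ContinuousMap.dist_apply_le_dist s).trans_lt hq)

lemma primitive_compLeftContinuous {G : Type*} [NormedAddCommGroup G] [NormedSpace ℝ G]
    [CompleteSpace E] [CompleteSpace G] (L : E →L[ℝ] G) (g : C(I, E)) (s : I) :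
    primitive (L.compLeftContinuous ℝ I g) s = L (primitive g s) :=
  L.intervalIntegral_comp_comm
    ((g.continuous.comp continuous_projIcc).intervalIntegrable _ _)

lemma contDiff_compLeftContinuous {G : Type*} [NormedAddCommGroup G] [NormedSpace ℝ G]
    (L : E →L[ℝ] G) : ContDiff ℝ 1 (L.compLeftContinuous ℝ I) :=
  (L.compLeftContinuous ℝ I).contDiff

lemma contDiff_eval (s : I) : ContDiff ℝ 1 (fun γ : C(I, E) => γ s) :=
  (ContinuousMap.evalCLM ℝ s : C(I, E) →L[ℝ] E).contDiff

set_option maxHeartbeats 1000000 in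
lemma exists_contDiffAt_two_flow_of_contDiff [CompleteSpace E] {F : E → E}
    {T S B : E → E →L[ℝ] E} {y₀ : E} (hF : ContDiff ℝ 1 F) (hB : ContDiff ℝ 1 B)
    (hT : ContDiffAt ℝ 1 T y₀) (hS : ContDiffAt ℝ 1 S y₀)
    (hST : ∀ᶠ y in 𝓝 y₀, S y ∘L T y = ContinuousLinearMap.id ℝ E)
    (hid : ∀ᶠ y in 𝓝 y₀, ∀ h, fderiv ℝ T y (F y) h + T y (fderiv ℝ F y h) = B y (T y h)) :
    ∃ φ : ℝ × E → E, ContDiffAt ℝ 2 φ (0, y₀) ∧ (∀ᶠ y in 𝓝 y₀, φ (0, y) = y) ∧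
      ∀ᶠ q in 𝓝 ((0 : ℝ), y₀), fderiv ℝ φ q (1, 0) = F (φ q) := by
  let F' : E × (E →L[ℝ] E) → E × (E →L[ℝ] E) := fun p => (F p.1, B p.1 ∘L p.2)
  have hF' : ContDiff ℝ 1 F' :=
    (hF.comp contDiff_fst).prodMk ((hB.comp contDiff_fst).clm_comp contDiff_snd)
  obtain ⟨Γ', hΓ', hΓ'0, hΓ'eq⟩ := exists_contDiffAt_solution hF' (y₀, T y₀)
  let j : ℝ × E → ℝ × (E × (E →L[ℝ] E)) := fun q => (q.1, (q.2, T q.2))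
  have hj : ContDiffAt ℝ 1 j (0, y₀) := by
    refine contDiffAt_fst.prodMk (contDiffAt_snd.prodMk ?_)
    exact ContDiffAt.comp (0, y₀) (g := T) (f := Prod.snd) hT contDiffAt_snd
  let Γ : ℝ × E → C(I, E × (E →L[ℝ] E)) := fun q => Γ' (j q)
  have hΓ : ContDiffAt ℝ 1 Γ (0, y₀) := ContDiffAt.comp (0, y₀) (g := Γ') (f := j) hΓ' hj
  have hΓeq : ∀ᶠ q in 𝓝 ((0 : ℝ), y₀), Γ q = constCurve (q.2, T q.2) +
      q.1 • primitive ((⟨F', hF'.continuous⟩ : C(_, _)).comp (Γ q)) :=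
    hj.continuousAt.eventually hΓ'eq
  let P : C(I, E × (E →L[ℝ] E)) → C(I, E) :=
    (ContinuousLinearMap.fst ℝ E (E →L[ℝ] E)).compLeftContinuous ℝ I
  let γ : ℝ × E → C(I, E) := fun q => P (Γ q)
  have hP : ContDiff ℝ 1 P := contDiff_compLeftContinuous _
  have hγ : ContDiffAt ℝ 1 γ (0, y₀) := hP.contDiffAt.comp _ hΓ
  have hγ0 : γ (0, y₀) = constCurve y₀ := by
    have : Γ (0, y₀) = constCurve (y₀, T y₀) := hΓ'0
    ext s
    simp [γ, P, this]
  have hγeq : ∀ᶠ q in 𝓝 ((0 : ℝ), y₀), γ q = constCurve q.2 +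
      q.1 • primitive ((⟨F, hF.continuous⟩ : C(E, E)).comp (γ q)) := by
    filter_upwards [hΓeq] with q hq
    ext s
    have h1 := congrArg Prod.fst (DFunLike.congr_fun hq s)
    refine h1.trans ?_
    simp only [ContinuousMap.add_apply, ContinuousMap.smul_apply, Prod.fst_add, Prod.smul_fst,
      constCurve_apply]
    congr 2
    exact (primitive_compLeftContinuous (ContinuousLinearMap.fst ℝ E (E →L[ℝ] E)) _ s).symm
  have hγd : ∀ᶠ q in 𝓝 ((0 : ℝ), y₀), ∀ a h, fderiv ℝ γ q (a, h) = constCurve h +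
      (1 : ℝ) • primitive (a • (⟨F, hF.continuous⟩ : C(E, E)).comp (γ q) + q.1 • pointwiseApply
        ((⟨fderiv ℝ F, hF.continuous_fderiv one_ne_zero⟩ : C(E, E →L[ℝ] E)).comp (γ q))
        (fderiv ℝ γ q (a, h))) := by
    filter_upwards [hγeq.eventually_nhds, hγ.eventually (by simp)] with q hq hq' a h
    have hd := (hq'.differentiableAt one_ne_zero).hasFDerivAt
    have h1 := (((constCurve (E := E)).hasFDerivAt (x := q.2)).comp q hasFDerivAt_snd).add
      (hasFDerivAt_fst.smul (primitive.hasFDerivAt.comp q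
        ((hasFDerivAt_postcomp hF (γ q)).comp q hd)))
    have h2 := (h1.congr_of_eventuallyEq hq).unique hd
    have h3 := DFunLike.congr_fun h2 (a, h)
    refine h3.symm.trans ?_
    rw [one_smul, map_add, map_smul, map_smul, add_comm (a • _)]
    rfl
  have hcurve : ∀ {R : E → Prop}, (∀ᶠ y in 𝓝 y₀, R y) → ∀ᶠ q in 𝓝 ((0 : ℝ), y₀), ∀ s, R (γ q s) :=
    fun hR => eventually_forall_curve hγ.continuousAt hγ0 hR
  have hφd : ∀ᶠ q in 𝓝 ((0 : ℝ), y₀), ∀ a h, fderiv ℝ γ q (a, h) 1 =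
      a • F (γ q 1) + S (γ q 1) ((Γ q 1).2 h) := by
    filter_upwards [hΓeq, hγd, hcurve hST, hcurve hid, hcurve (hT.eventually (by simp))]
      with q hq hqd hqST hqid hqT a h
    obtain ⟨U, hU0, hUs, hUd⟩ := exists_hasDerivAt_of_eq_primitive hq
    have hu : ∀ s, HasDerivAt (fun s => (U s).1) (q.1 • F (γ q (projIcc 0 1 zero_le_one s))) s :=
      fun s => (hUd s).fst
    have hW : ∀ s, HasDerivAt (fun s => (U s).2)
      (q.1 • (B (γ q (projIcc 0 1 zero_le_one s)) ∘L (Γ q (projIcc 0 1 zero_le_one s)).2)) s :=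
      fun s => (hUd s).snd
    have hγU : ∀ s : I, γ q s = (U s).1 := fun s => congrArg Prod.fst (hUs s).symm
    -- time derivative
    have h1 : fderiv ℝ γ q (1, 0) 1 = F (γ q 1) := by
      obtain ⟨z, hz0, hzs, hzd⟩ := exists_hasDerivAt_of_eq_primitive (hqd 1 0)
      have := eq_of_hasDerivAt_affine (A := q.1 •
        (⟨fderiv ℝ F, hF.continuous_fderiv one_ne_zero⟩ : C(E, E →L[ℝ] E)).comp (γ q))
        (b := (⟨F, hF.continuous⟩ : C(E, E)).comp (γ q)) (u := z) (w := fun s => s • F (U s).1)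
        ?_ ?_ (by simpa using hz0) 1
      · rw [← hzs, this, hγU]; simp
      · intro s
        have := hzd s
        simp only [projIcc_val] at this
        simpa [hzs] using this
      · intro s
        have h2 := (hF.differentiable one_ne_zero (U s).1).hasFDerivAt.comp_hasDerivAt (s : ℝ) (hu s)
        have := (hasDerivAt_id (s : ℝ)).smul h2
        refine this.congr_deriv ?_
        simp [hγU, smul_smul, mul_comm, add_comm]
    -- space derivative
    have h2 : fderiv ℝ γ q (0, h) 1 = S (γ q 1) ((Γ q 1).2 h) := by
      obtain ⟨z, hz0, hzs, hzd⟩ := exists_hasDerivAt_of_eq_primitive (hqd 0 h)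
      have := eq_of_hasDerivAt_affine (A := q.1 • (⟨B, hB.continuous⟩ : C(E, E →L[ℝ] E)).comp (γ q))
        (b := 0) (u := fun s => T (U s).1 (z s)) (w := fun s => (U s).2 h)
        ?_ ?_ (by simp [hU0, hz0]) 1
      · rw [← hUs]
        refine Eq.trans ?_ (congrArg (S (γ q 1)) this)
        rw [← hzs, hγU]
        have h3 := DFunLike.congr_fun (hqST 1) (z 1)
        rw [hγU] at h3
        exact h3.symm
      · intro s
        have hTs : HasFDerivAt T (fderiv ℝ T (U s).1) (U s).1 := by
          rw [← hγU]
          exact ((hqT s).differentiableAt one_ne_zero).hasFDerivAt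
        have h3 := (hTs.comp_hasDerivAt (s : ℝ) (hu s)).clm_apply (hzd s)
        refine h3.congr_deriv ?_
        have h4 := hqid s (z s)
        simp only [projIcc_val]
        simp [← hzs, hγU] at h4 ⊢
        rw [← smul_add, h4]
      · intro s
        have h3 := (hW s).clm_apply (hasDerivAt_const (s : ℝ) h)
        refine h3.congr_deriv ?_
        simp [hUs]
    rw [show ((a, h) : ℝ × E) = a • ((1 : ℝ), (0 : E)) + (0, h) by simp, map_add, map_smul,
      ContinuousMap.add_apply, ContinuousMap.smul_apply, h1, h2]
  let ev : C(I, E) →L[ℝ] E := ContinuousMap.evalCLM ℝ 1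
  have hevγ : ∀ q, ContDiffAt ℝ 1 γ q → HasFDerivAt (fun q => γ q 1) (ev ∘L fderiv ℝ γ q) q :=
    fun q hq => ev.hasFDerivAt.comp q (hq.differentiableAt one_ne_zero).hasFDerivAt
  have hφ1 : ContDiffAt ℝ 1 (fun q => γ q 1) (0, y₀) := ev.contDiff.contDiffAt.comp _ hγ
  have hγ01 : γ (0, y₀) 1 = y₀ := by rw [hγ0]; rfl
  refine ⟨fun q => γ q 1, ?_, ?_, ?_⟩
  · refine contDiffAt_succ_iff_hasFDerivAt (n := 1).2 ⟨fun q =>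
      (ContinuousLinearMap.fst ℝ ℝ E).smulRight (F (γ q 1)) +
        (S (γ q 1) ∘L (Γ q 1).2) ∘L ContinuousLinearMap.snd ℝ ℝ E, eventually_iff_exists_mem.1 ?_, ?_⟩
    · filter_upwards [hγ.eventually (by simp), hφd] with q hq hqd
      refine (hevγ q hq).congr_fderiv (ContinuousLinearMap.ext fun ⟨a, h⟩ => ?_)
      exact hqd a h
    · have hW : ContDiffAt ℝ 1 (fun q => (Γ q 1).2) (0, y₀) :=
        contDiffAt_snd.comp _ ((contDiff_eval 1).contDiffAt.comp _ hΓ)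
      have hSγ : ContDiffAt ℝ 1 (fun q => S (γ q 1)) (0, y₀) :=
        ContDiffAt.comp (g := S) (f := fun q => γ q 1) _ (by rwa [hγ01]) hφ1
      have hFγ : ContDiffAt ℝ 1 (fun q => F (γ q 1)) (0, y₀) :=
        hF.contDiffAt.comp _ hφ1
      refine ContDiffAt.add ?_ ((hSγ.clm_comp hW).clm_comp contDiffAt_const)
      exact ((ContinuousLinearMap.smulRightL ℝ (ℝ × E) E (.fst ℝ ℝ E)).contDiff.contDiffAt.comp _ hFγ)
  · have : Tendsto (fun y : E => ((0 : ℝ), y)) (𝓝 y₀) (𝓝 (0, y₀)) :=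
      (Continuous.prodMk_right 0).tendsto _
    filter_upwards [this.eventually hγeq] with y hy
    rw [hy]
    simp
  · filter_upwards [hγ.eventually (by simp), hφd] with q hq hqd
    rw [(hevγ q hq).fderiv]
    simp [ev, hqd]

end Flow

section LocalFlow

variable {E : Type*} [NormedAddCommGroup E] [NormedSpace ℝ E] [FiniteDimensional ℝ E]

lemma exists_contDiff_eventuallyEq {G : Type*} [NormedAddCommGroup G] [NormedSpace ℝ G]
    {F : E → G} {y₀ : E} (hF : ContDiffAt ℝ 1 F y₀) :
    ∃ F' : E → G, ContDiff ℝ 1 F' ∧ F' =ᶠ[𝓝 y₀] F := by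
  obtain ⟨r, hr, h⟩ := Metric.eventually_nhds_iff.1 (hF.eventually (by simp))
  let b : ContDiffBump y₀ := ⟨r / 4, r / 2, by positivity, by linarith⟩
  refine ⟨fun y => b y • F y, contDiff_iff_contDiffAt.2 fun y => ?_, ?_⟩
  · by_cases hy : dist y y₀ < r
    · exact b.contDiffAt.smul (h hy)
    · have : (fun y => b y • F y) =ᶠ[𝓝 y] fun _ => 0 := by
        have ho : IsOpen {z | r / 2 < dist z y₀} := isOpen_lt (by fun_prop) (by fun_prop)
        filter_upwards [ho.mem_nhds (show r / 2 < dist y y₀ by linarith)] with z hz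
        rw [b.zero_of_le_dist (le_of_lt hz), zero_smul]
      exact contDiffAt_const.congr_of_eventuallyEq this
  · filter_upwards [b.eventuallyEq_one] with y hy
    simp [hy]

/-- A `C¹` vector field with a `C¹` moving frame `T`, in which the derivative of the flow solves
a linear equation with `C¹` coefficients, has a `C²` local flow. -/
lemma exists_contDiffAt_two_flow {F : E → E} {T S C : E → E →L[ℝ] E} {y₀ : E}
    (hF : ContDiffAt ℝ 1 F y₀) (hC : ContDiffAt ℝ 1 C y₀)
    (hT : ContDiffAt ℝ 1 T y₀) (hS : ContDiffAt ℝ 1 S y₀)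
    (hST : ∀ᶠ y in 𝓝 y₀, S y ∘L T y = ContinuousLinearMap.id ℝ E)
    (hid : ∀ᶠ y in 𝓝 y₀, ∀ h, fderiv ℝ T y (F y) h + T y (fderiv ℝ F y h) = C y h) :
    ∃ φ : ℝ × E → E, ContDiffAt ℝ 2 φ (0, y₀) ∧ (∀ᶠ y in 𝓝 y₀, φ (0, y) = y) ∧
      ∀ᶠ q in 𝓝 ((0 : ℝ), y₀), fderiv ℝ φ q (1, 0) = F (φ q) := by
  have := FiniteDimensional.complete ℝ E
  obtain ⟨F', hF', hFF'⟩ := exists_contDiff_eventuallyEq hF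
  obtain ⟨B, hB, hBC⟩ := exists_contDiff_eventuallyEq (hC.clm_comp hS)
  obtain ⟨φ, h1, h2, h3⟩ := exists_contDiffAt_two_flow_of_contDiff (F := F') (B := B) hF' hB hT hS
    hST (by
      filter_upwards [hST, hid, hFF'.eventually_nhds, hBC] with y hy1 hy2 hy3 hy4 h
      have hy3' : F' =ᶠ[𝓝 y] F := hy3
      rw [hy3'.fderiv_eq, hy3'.eq_of_nhds, hy2, hy4]
      exact congrArg (C y) (DFunLike.congr_fun hy1 h).symm)
  refine ⟨φ, h1, h2, ?_⟩
  have h4 : Tendsto φ (𝓝 (0, y₀)) (𝓝 y₀) := by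
    have := h1.continuousAt.tendsto
    rwa [h2.self_of_nhds] at this
  filter_upwards [h3, h4.eventually hFF'] with q hq hq'
  rw [hq, hq']

end LocalFlow

section GeodesicFlow

variable {E : Type*} [NormedAddCommGroup E] [InnerProductSpace ℝ E]

/-- The shear `(a, b) ↦ (a, b + ⟨L a, v⟩ n)`, without its identity part. -/
def shear (L : E →L[ℝ] E) (n v : E) : E × E →L[ℝ] E × E :=
  (innerSL ℝ v ∘L L ∘L .fst ℝ E E).smulRight ((0 : E), n)

lemma shear_apply (L : E →L[ℝ] E) (n v : E) (h : E × E) :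
    shear L n v h = (0, ⟪L h.1, v⟫ • n) := by
  simp [shear, real_inner_comm]

/-- The vector field on the tangent bundle whose integral curves are the geodesics of the level
sets with normal differential `L` and normalized normal `n`. -/
def spray (L : E → E →L[ℝ] E) (n : E → E) (y : E × E) : E × E :=
  (y.2, -(⟪L y.1 y.2, y.2⟫ • n y.1))

/-- The coefficients of the sheared linearisation of `spray`. -/
def jacobiCoeff (L N : E →L[ℝ] E) (n v : E) : E × E →L[ℝ] E × E :=
  .inl ℝ E E ∘L .snd ℝ E E +
    (-(innerSL ℝ (L v) ∘L .snd ℝ E E) +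
      innerSL ℝ (-(⟪L v, v⟫ • n)) ∘L L ∘L .fst ℝ E E).smulRight ((0 : E), n) +
    .inr ℝ E E ∘L (-(⟪L v, v⟫ • N ∘L .fst ℝ E E) +
      (innerSL ℝ v ∘L L ∘L .fst ℝ E E).smulRight (N v))

lemma jacobiCoeff_apply (L N : E →L[ℝ] E) (n v : E) (h : E × E) :
    jacobiCoeff L N n v h = (h.2, (-⟪L v, h.2⟫ + ⟪L h.1, -(⟪L v, v⟫ • n)⟫) • n -
      ⟪L v, v⟫ • N h.1 + ⟪L h.1, v⟫ • N v) := by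
  simp [jacobiCoeff, real_inner_comm, inner_smul_right]
  module

lemma fderiv_spray {L : E → E →L[ℝ] E} {n : E → E} {y : E × E}
    (hL : DifferentiableAt ℝ L y.1) (hn : DifferentiableAt ℝ n y.1) (h : E × E) :
    fderiv ℝ (spray L n) y h = (h.2, -((⟪fderiv ℝ L y.1 h.1 y.2, y.2⟫ + ⟪L y.1 h.2, y.2⟫ +
      ⟪L y.1 y.2, h.2⟫) • n y.1 + ⟪L y.1 y.2, y.2⟫ • fderiv ℝ n y.1 h.1)) := by
  have h1 : HasFDerivAt (fun y : E × E => y.1) (.fst ℝ E E) y := hasFDerivAt_fst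
  have h2 : HasFDerivAt (fun y : E × E => y.2) (.snd ℝ E E) y := hasFDerivAt_snd
  have h3 := (hL.hasFDerivAt.comp y h1).clm_apply h2
  have h4 := ((h3.inner ℝ h2).smul (hn.hasFDerivAt.comp y h1)).neg
  have h5 : HasFDerivAt (spray L n) _ y := h2.prodMk h4
  rw [h5.fderiv]
  simp [inner_add_left]
  module

lemma fderiv_shear {L : E → E →L[ℝ] E} {n : E → E} {y : E × E}
    (hL : DifferentiableAt ℝ L y.1) (hn : DifferentiableAt ℝ n y.1)
    (hT : DifferentiableAt ℝ (fun y : E × E => .id ℝ (E × E) + shear (L y.1) (n y.1) y.2) y)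
    (k h : E × E) :
    fderiv ℝ (fun y : E × E => .id ℝ (E × E) + shear (L y.1) (n y.1) y.2) y k h =
      (0, (⟪fderiv ℝ L y.1 k.1 h.1, y.2⟫ + ⟪L y.1 h.1, k.2⟫) • n y.1 +
        ⟪L y.1 h.1, y.2⟫ • fderiv ℝ n y.1 k.1) := by
  have h1 : HasFDerivAt (fun y : E × E => y.1) (.fst ℝ E E) y := hasFDerivAt_fst
  have h2 : HasFDerivAt (fun y : E × E => y.2) (.snd ℝ E E) y := hasFDerivAt_snd
  have h3 := (hL.hasFDerivAt.comp y h1).clm_apply (hasFDerivAt_const h.1 y)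
  have h4 := (h3.inner ℝ h2).smul (hn.hasFDerivAt.comp y h1)
  have h5 := ((hasFDerivAt_const (0 : E) y).prodMk h4).const_add h
  have h7 := hT.hasFDerivAt.clm_apply (hasFDerivAt_const h y)
  have h8 := DFunLike.congr_fun (h7.unique (h5.congr_of_eventuallyEq
    (Eventually.of_forall fun y => by simp [shear_apply]))) k
  simp only [ContinuousLinearMap.comp_zero, zero_add, ContinuousLinearMap.flip_apply] at h8
  rw [h8]
  simp [add_comm]

lemma ContDiffAt.innerSL_apply {G : Type*} [NormedAddCommGroup G] [NormedSpace ℝ G] {g : G → E}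
    {k : WithTop ℕ∞} {y : G} (hg : ContDiffAt ℝ k g y) :
    ContDiffAt ℝ k (fun y => innerSL ℝ (g y)) y :=
  ((innerSL ℝ : E →L[ℝ] E →L[ℝ] ℝ).contDiff.contDiffAt (x := g y)).comp y hg

lemma exists_contDiffAt_two_geodesicFlow [FiniteDimensional ℝ E] {p n : E → E} {x₀ : E}
    (hp : ContDiffAt ℝ 2 p x₀) (hn : ContDiffAt ℝ 2 n x₀) (v₀ : E) :
    ∃ φ : ℝ × (E × E) → E × E, ContDiffAt ℝ 2 φ (0, (x₀, v₀)) ∧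
      (∀ᶠ y in 𝓝 (x₀, v₀), φ (0, y) = y) ∧
      ∀ᶠ q in 𝓝 ((0 : ℝ), (x₀, v₀)), fderiv ℝ φ q (1, 0) = spray (fderiv ℝ p) n (φ q) := by
  have hL : ContDiffAt ℝ 1 (fderiv ℝ p) x₀ := hp.fderiv_right le_rfl
  have hN : ContDiffAt ℝ 1 (fderiv ℝ n) x₀ := hn.fderiv_right le_rfl
  have hn1 : ContDiffAt ℝ 1 n x₀ := hn.of_le (by norm_num)
  have e1 : ContDiffAt ℝ 1 (fun y : E × E => fderiv ℝ p y.1) (x₀, v₀) :=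
    ContDiffAt.comp (x₀, v₀) (g := fderiv ℝ p) (f := Prod.fst) hL contDiffAt_fst
  have e2 : ContDiffAt ℝ 1 (fun y : E × E => fderiv ℝ n y.1) (x₀, v₀) :=
    ContDiffAt.comp (x₀, v₀) (g := fderiv ℝ n) (f := Prod.fst) hN contDiffAt_fst
  have e3 : ContDiffAt ℝ 1 (fun y : E × E => n y.1) (x₀, v₀) :=
    ContDiffAt.comp (x₀, v₀) (g := n) (f := Prod.fst) hn1 contDiffAt_fst
  have hshear : ContDiffAt ℝ 1 (fun y : E × E => shear (fderiv ℝ p y.1) (n y.1) y.2) (x₀, v₀) := by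
    exact ContDiffAt.smulRight ((contDiffAt_snd.innerSL_apply).clm_comp
      (e1.clm_comp contDiffAt_const)) (contDiffAt_const.prodMk e3)
  have e4 : ContDiffAt ℝ 1 (fun y : E × E => fderiv ℝ p y.1 y.2) (x₀, v₀) :=
    e1.clm_apply contDiffAt_snd
  have e5 : ContDiffAt ℝ 1 (fun y : E × E => ⟪fderiv ℝ p y.1 y.2, y.2⟫) (x₀, v₀) :=
    e4.inner ℝ contDiffAt_snd
  have hnear : ∀ᶠ y : E × E in 𝓝 (x₀, v₀), ContDiffAt ℝ 2 p y.1 ∧ ContDiffAt ℝ 2 n y.1 :=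
    (continuous_fst.tendsto (x₀, v₀)).eventually
      ((hp.eventually (by simp)).and (hn.eventually (by simp)))
  refine exists_contDiffAt_two_flow
    (T := fun y => .id ℝ (E × E) + shear (fderiv ℝ p y.1) (n y.1) y.2)
    (S := fun y => .id ℝ (E × E) - shear (fderiv ℝ p y.1) (n y.1) y.2)
    (C := fun y => jacobiCoeff (fderiv ℝ p y.1) (fderiv ℝ n y.1) (n y.1) y.2)
    ?_ ?_ (contDiffAt_const.add hshear) (contDiffAt_const.sub hshear) ?_ ?_
  · exact contDiffAt_snd.prodMk (e5.smul e3).neg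
  · refine (contDiffAt_const.add (ContDiffAt.smulRight (ContDiffAt.add ?_ ?_)
      (contDiffAt_const.prodMk e3))).add (contDiffAt_const.clm_comp (ContDiffAt.add ?_ ?_))
    · exact (e4.innerSL_apply.clm_comp contDiffAt_const).neg
    · exact (e5.smul e3).neg.innerSL_apply.clm_comp (e1.clm_comp contDiffAt_const)
    · exact (e5.smul (e2.clm_comp contDiffAt_const)).neg
    · exact ContDiffAt.smulRight ((contDiffAt_snd.innerSL_apply).clm_comp
        (e1.clm_comp contDiffAt_const)) (e2.clm_apply contDiffAt_snd)
  · refine Eventually.of_forall fun y => ContinuousLinearMap.ext fun h => ?_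
    simp [shear_apply]
  · filter_upwards [hnear, (contDiffAt_const.add hshear).eventually (by simp)] with y hy hT h
    have hL' : DifferentiableAt ℝ (fderiv ℝ p) y.1 :=
      (hy.1.fderiv_right (m := 1) le_rfl).differentiableAt one_ne_zero
    have hn' : DifferentiableAt ℝ n y.1 := hy.2.differentiableAt two_ne_zero
    rw [fderiv_shear hL' hn' (hT.differentiableAt one_ne_zero), fderiv_spray hL' hn', jacobiCoeff_apply]
    have hsymm : fderiv ℝ (fderiv ℝ p) y.1 y.2 h.1 = fderiv ℝ (fderiv ℝ p) y.1 h.1 y.2 :=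
      (hy.1.isSymmSndFDerivAt (by simp)) y.2 h.1
    simp only [spray, add_apply, ContinuousLinearMap.id_apply, shear_apply,
      hsymm, Prod.mk_add_mk, add_zero, zero_add]
    congr 1
    module

end GeodesicFlow

section Along

variable {E : Type*} [NormedAddCommGroup E] [InnerProductSpace ℝ E]

/-- The orthogonal projection along a unit vector. -/
def projAlong (e : E) : E →L[ℝ] E := .id ℝ E - (innerSL ℝ e).smulRight e

lemma projAlong_apply (e u : E) : projAlong e u = u - ⟪e, u⟫ • e := by simp [projAlong]

lemma inner_projAlong {e : E} (he : ‖e‖ = 1) (u : E) : ⟪e, projAlong e u⟫ = 0 := by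
  simp [projAlong_apply, inner_sub_right, inner_smul_right, he]

lemma projAlong_of_inner_eq_zero {e u : E} (h : ⟪e, u⟫ = 0) : projAlong e u = u := by
  simp [projAlong_apply, h]

/-- The segment from the projection of `u` to `u`. -/
def alongCurve (e u : E) (t : ℝ) : E := projAlong e u + (t * ⟪e, u⟫) • e

lemma alongCurve_zero (e u : E) : alongCurve e u 0 = projAlong e u := by simp [alongCurve]

lemma alongCurve_one (e u : E) : alongCurve e u 1 = u := by simp [alongCurve, projAlong_apply]

lemma projAlong_alongCurve {e : E} (he : ‖e‖ = 1) (u : E) (t : ℝ) :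
    projAlong e (alongCurve e u t) = projAlong e u := by
  rw [projAlong_apply, alongCurve, inner_add_right, inner_projAlong he, inner_smul_right,
    real_inner_self_eq_norm_sq, he]
  simp

lemma eventually_alongCurve (e : E) {Q : E → Prop} (hQ : ∀ᶠ u in 𝓝 (0 : E), Q u) :
    ∀ᶠ u in 𝓝 (0 : E), ∀ t ∈ Icc (0 : ℝ) 1, Q (alongCurve e u t) := by
  have hc : Continuous fun q : E × ℝ => alongCurve e q.1 q.2 := by
    unfold alongCurve
    exact ((projAlong e).continuous.comp continuous_fst).add
      ((continuous_snd.mul (continuous_const.inner continuous_fst)).smul continuous_const)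
  have := isCompact_Icc (a := (0 : ℝ)) (b := 1)
  refine this.eventually_forall_of_forall_eventually (x₀ := (0 : E))
    (P := fun u t => Q (alongCurve e u t)) fun t _ => ?_
  have h0 : alongCurve e 0 t = 0 := by simp [alongCurve]
  rw [← h0] at hQ
  exact (hc.tendsto (0, t)).eventually hQ

lemma eq_of_fderiv_along {G : Type*} [NormedAddCommGroup G] [NormedSpace ℝ G] {g : E → G} {e u : E}
    (h : ∀ t ∈ Icc (0 : ℝ) 1, DifferentiableAt ℝ g (alongCurve e u t) ∧
      fderiv ℝ g (alongCurve e u t) e = 0) : ∀ t ∈ Icc (0 : ℝ) 1,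
      g (alongCurve e u t) = g (projAlong e u) := by
  intro t ht
  have hd : ∀ t, HasDerivAt (alongCurve e u) (⟪e, u⟫ • e) t := by
    intro t
    have := (((hasDerivAt_id t).mul_const ⟪e, u⟫).smul_const e).const_add (projAlong e u)
    rw [one_mul] at this
    exact this
  have hg : ∀ t ∈ Icc (0 : ℝ) 1, HasDerivAt (fun t => g (alongCurve e u t)) 0 t := by
    intro t ht
    have := (h t ht).1.hasFDerivAt.comp_hasDerivAt t (hd t)
    rwa [map_smul, (h t ht).2, smul_zero] at this
  have := constant_of_has_deriv_right_zero (f := fun t => g (alongCurve e u t)) (a := 0) (b := 1)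
    (fun t ht => (hg t ht).continuousAt.continuousWithinAt)
    (fun t ht => (hg t (Ico_subset_Icc_self ht)).hasDerivWithinAt) t ht
  rw [this, alongCurve_zero]

lemma eventually_eq_projAlong {G : Type*} [NormedAddCommGroup G] [NormedSpace ℝ G] {g : E → G}
    {e : E} (h : ∀ᶠ u in 𝓝 (0 : E), DifferentiableAt ℝ g u ∧ fderiv ℝ g u e = 0) :
    ∀ᶠ u in 𝓝 (0 : E), g u = g (projAlong e u) := by
  filter_upwards [eventually_alongCurve e h] with u hu
  have := eq_of_fderiv_along hu 1 (by simp)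
  rwa [alongCurve_one] at this

lemma tendsto_projAlong_zero (e : E) : Tendsto (projAlong e) (𝓝 0) (𝓝 0) := by
  have := (projAlong e).continuous.tendsto 0
  rwa [map_zero] at this

end Along

section InitialData

variable {E : Type*} [NormedAddCommGroup E] [InnerProductSpace ℝ E]

/-- A parabolic hypersurface through `x` orthogonal to `e` at `x`. -/
def parabola (x e w : E) : E := x + w - (⟪w, w⟫ / 2) • e

lemma hasFDerivAt_parabola (x e w : E) :
    HasFDerivAt (parabola x e) (.id ℝ E - (innerSL ℝ w).smulRight e) w := by
  have h1 := (((hasFDerivAt_id w).inner ℝ (hasFDerivAt_id w)).mul_const (1 / 2)).smul_const e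
  have h2 := ((hasFDerivAt_id w).const_add x).sub h1
  refine (h2.congr_of_eventuallyEq (Eventually.of_forall fun u => ?_)).congr_fderiv ?_
  · simp [parabola, div_eq_mul_inv]
  · ext h
    simp [real_inner_comm]
    module

lemma contDiff_parabola (x e : E) {k : WithTop ℕ∞} : ContDiff ℝ k (parabola x e) :=
  (contDiff_const.add contDiff_id).sub
    (((contDiff_id.inner ℝ contDiff_id).div_const 2).smul contDiff_const)

lemma parabola_zero (x e : E) : parabola x e 0 = x := by simp [parabola]

/-- Initial directions for the geodesics emanating orthogonally from the parabolic front. -/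
lemma exists_initial_direction {p : E → E} {x₀ e : E} (hp : ContDiffAt ℝ 2 p x₀) (hp0 : p x₀ ≠ 0)
    (he : ‖e‖ = 1) (hpe : ⟪p x₀, e⟫ = 0) :
    ∃ α β : E → ℝ, ContDiffAt ℝ 2 α 0 ∧ ContDiffAt ℝ 2 β 0 ∧ α 0 = 1 ∧ β 0 = 0 ∧
      ∀ᶠ w in 𝓝 0, ‖α w • (e + w) + β w • p (parabola x₀ e w)‖ = 1 ∧
        ⟪p (parabola x₀ e w), α w • (e + w) + β w • p (parabola x₀ e w)⟫ = 0 := by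
  let r : E → E := fun w => p (parabola x₀ e w)
  have hr : ContDiffAt ℝ 2 r 0 :=
    ContDiffAt.comp (g := p) (f := parabola x₀ e) 0 (by rwa [parabola_zero])
      (contDiff_parabola x₀ e).contDiffAt
  have hr0 : r 0 = p x₀ := by simp [r, parabola_zero]
  let b : E → ℝ := fun w => ⟪r w, e + w⟫ / ⟪r w, r w⟫
  have hew : ContDiffAt ℝ 2 (fun w => e + w) 0 := contDiffAt_const.add contDiffAt_id
  have hb : ContDiffAt ℝ 2 b 0 := (hr.inner ℝ hew).div (hr.inner ℝ hr) (by simpa [hr0] using hp0)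
  have hb0 : b 0 = 0 := by simp [b, hr0, hpe]
  let q : E → E := fun w => e + w - b w • r w
  have hq : ContDiffAt ℝ 2 q 0 := hew.sub (hb.smul hr)
  have hq0 : q 0 = e := by simp [q, hb0]
  have hqne : q 0 ≠ 0 := by
    rw [hq0]
    rintro rfl
    simp at he
  have hα : ContDiffAt ℝ 2 (fun w => ‖q w‖⁻¹) 0 := (hq.norm ℝ hqne).inv (by simpa using hqne)
  refine ⟨fun w => ‖q w‖⁻¹, fun w => -(‖q w‖⁻¹ * b w), hα, (hα.mul hb).neg, by simp [hq0, he],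
    by simp [hb0], ?_⟩
  filter_upwards [hq.continuousAt.eventually_ne hqne,
    hr.continuousAt.eventually_ne (hr0 ▸ hp0)] with w hw hrw
  have hz : ‖q w‖⁻¹ • (e + w) + -(‖q w‖⁻¹ * b w) • p (parabola x₀ e w) = ‖q w‖⁻¹ • q w := by
    simp only [q, r]
    module
  rw [hz]
  refine ⟨by rw [norm_smul, norm_inv, norm_norm, inv_mul_cancel₀ (by simpa using hw)], ?_⟩
  rw [inner_smul_right]
  have : ⟪r w, r w⟫ ≠ 0 := by simpa using hrw
  have h2 : ⟪r w, q w⟫ = 0 := by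
    simp only [q, b, inner_sub_right, inner_smul_right]
    rw [div_mul_cancel₀ _ this, sub_self]
  rw [show p (parabola x₀ e w) = r w from rfl, h2, mul_zero]

end InitialData

section GeodesicFamily

variable {E : Type*} [NormedAddCommGroup E] [InnerProductSpace ℝ E]

lemma exists_geodesic_family [FiniteDimensional ℝ E] {p n ζ : E → E} {x₀ e : E}
    (hp : ContDiffAt ℝ 2 p x₀) (hn : ContDiffAt ℝ 2 n x₀) (he : ‖e‖ = 1)
    (hζ : ContDiffAt ℝ 2 ζ 0) (hζ0 : ζ 0 = e) :
    ∃ G Z : E → E, ContDiffAt ℝ 2 G 0 ∧ ContDiffAt ℝ 2 Z 0 ∧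
      (∀ᶠ u in 𝓝 0, fderiv ℝ G u e = Z u) ∧
      (∀ᶠ u in 𝓝 0, fderiv ℝ Z u e = -(⟪fderiv ℝ p (G u) (Z u), Z u⟫ • n (G u))) ∧
      ∀ᶠ u in 𝓝 0, G (projAlong e u) = parabola x₀ e (projAlong e u) ∧
        Z (projAlong e u) = ζ (projAlong e u) := by
  obtain ⟨φ, hφ, hφ0, hφd⟩ := exists_contDiffAt_two_geodesicFlow hp hn e
  let Y : E → E × E := fun w => (parabola x₀ e w, ζ w)
  have hY : ContDiffAt ℝ 2 Y 0 := (contDiff_parabola x₀ e).contDiffAt.prodMk hζ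
  have hY0 : Y 0 = (x₀, e) := by simp [Y, parabola_zero, hζ0]
  have hYπ : ContDiffAt ℝ 2 (fun u => Y (projAlong e u)) 0 :=
    ContDiffAt.comp (g := Y) (f := projAlong e) 0 (by rwa [map_zero]) (projAlong e).contDiff.contDiffAt
  let y : E → ℝ × (E × E) := fun u => (⟪e, u⟫, Y (projAlong e u))
  have hy : ContDiffAt ℝ 2 y 0 := (contDiffAt_const.inner ℝ contDiffAt_id).prodMk hYπ
  have hy0 : y 0 = (0, (x₀, e)) := by simp [y, hY0]
  let Ψ : E → E × E := fun u => φ (y u)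
  have hΨ : ContDiffAt ℝ 2 Ψ 0 := ContDiffAt.comp (g := φ) (f := y) 0 (by rwa [hy0]) hy
  have hyt : Tendsto y (𝓝 0) (𝓝 (0, (x₀, e))) := by
    rw [← hy0]
    exact hy.continuousAt
  have hΨd : ∀ᶠ u in 𝓝 0, fderiv ℝ Ψ u e = spray (fderiv ℝ p) n (Ψ u) := by
    filter_upwards [hyt.eventually hφd, hyt.eventually (hφ.eventually (by simp)),
      (tendsto_projAlong_zero e).eventually (hY.eventually (by simp))] with u h1 h2 h3
    have h4 : HasFDerivAt (fun u => Y (projAlong e u)) (fderiv ℝ Y (projAlong e u) ∘L projAlong e) u :=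
      (h3.differentiableAt two_ne_zero).hasFDerivAt.comp u (projAlong e).hasFDerivAt
    have h5 : HasFDerivAt y _ u := (innerSL ℝ e).hasFDerivAt.prodMk h4
    have h6 : HasFDerivAt Ψ _ u := (h2.differentiableAt two_ne_zero).hasFDerivAt.comp u h5
    have h7 : projAlong e e = 0 := by simp [projAlong_apply, he]
    rw [h6.fderiv, ← h1]
    simp [h7, he]
  have hd : ∀ᶠ u in 𝓝 0, DifferentiableAt ℝ Ψ u := by
    filter_upwards [hΨ.eventually (by simp)] with u hu using hu.differentiableAt two_ne_zero
  refine ⟨fun u => (Ψ u).1, fun u => (Ψ u).2, hΨ.fst, hΨ.snd, ?_, ?_, ?_⟩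
  · filter_upwards [hΨd, hd] with u h1 h2
    rw [h2.hasFDerivAt.fst.fderiv]
    exact congrArg Prod.fst h1
  · filter_upwards [hΨd, hd] with u h1 h2
    rw [h2.hasFDerivAt.snd.fderiv]
    exact congrArg Prod.snd h1
  · have hYt : Tendsto Y (𝓝 0) (𝓝 (x₀, e)) := by
      rw [← hY0]
      exact hY.continuousAt
    filter_upwards [(tendsto_projAlong_zero e).eventually (hYt.eventually hφ0)] with u hu
    have h1 : Ψ (projAlong e u) = Y (projAlong e u) := by
      simp only [Ψ, y]
      rw [inner_projAlong he, projAlong_of_inner_eq_zero (inner_projAlong he u), hu]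
    exact ⟨congrArg Prod.fst h1, congrArg Prod.snd h1⟩

end GeodesicFamily

section Invariants

variable {E : Type*} [NormedAddCommGroup E] [InnerProductSpace ℝ E]

lemma eventually_orthogonal_of_geodesic {p n G Z : E → E} {x₀ e : E}
    (hp : ContDiffAt ℝ 2 p x₀) (hpn : ∀ᶠ x in 𝓝 x₀, ⟪p x, n x⟫ = 1)
    (hG : ContDiffAt ℝ 2 G 0) (hZ : ContDiffAt ℝ 2 Z 0) (hG0 : G 0 = x₀)
    (hGe : ∀ᶠ u in 𝓝 0, fderiv ℝ G u e = Z u)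
    (hZe : ∀ᶠ u in 𝓝 0, fderiv ℝ Z u e = -(⟪fderiv ℝ p (G u) (Z u), Z u⟫ • n (G u)))
    (h0 : ∀ᶠ u in 𝓝 0, ⟪p (G (projAlong e u)), Z (projAlong e u)⟫ = 0) :
    ∀ᶠ u in 𝓝 0, ⟪p (G u), Z u⟫ = 0 := by
  have hGt : Tendsto G (𝓝 0) (𝓝 x₀) := by
    rw [← hG0]
    exact hG.continuousAt
  have key : ∀ᶠ u in 𝓝 0, DifferentiableAt ℝ (fun u => ⟪p (G u), Z u⟫) u ∧
      fderiv ℝ (fun u => ⟪p (G u), Z u⟫) u e = 0 := by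
    filter_upwards [hGe, hZe, hG.eventually (by simp), hZ.eventually (by simp),
      hGt.eventually (hp.eventually (by simp)), hGt.eventually hpn] with u h1 h2 h3 h4 h5 h6
    have h7 := (h5.differentiableAt two_ne_zero).hasFDerivAt.comp u
      (h3.differentiableAt two_ne_zero).hasFDerivAt
    have h8 : HasFDerivAt (fun u => ⟪p (G u), Z u⟫) _ u :=
      h7.inner ℝ (h4.differentiableAt two_ne_zero).hasFDerivAt
    refine ⟨h8.differentiableAt, ?_⟩
    rw [h8.fderiv]
    simp [h1, h2, inner_smul_right, h6]
  filter_upwards [eventually_eq_projAlong key, h0] with u h1 h2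
  rw [h1, h2]

lemma eventually_norm_eq_one_of_geodesic {p n G Z : E → E} {x₀ e : E}
    (hG : ContinuousAt G 0) (hG0 : G 0 = x₀) (hZ : ContDiffAt ℝ 2 Z 0)
    (hn : ∀ᶠ x in 𝓝 x₀, ∃ c : ℝ, n x = c • p x)
    (hZe : ∀ᶠ u in 𝓝 0, fderiv ℝ Z u e = -(⟪fderiv ℝ p (G u) (Z u), Z u⟫ • n (G u)))
    (hpZ : ∀ᶠ u in 𝓝 0, ⟪p (G u), Z u⟫ = 0) (h0 : ∀ᶠ u in 𝓝 0, ‖Z (projAlong e u)‖ = 1) :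
    ∀ᶠ u in 𝓝 0, ‖Z u‖ = 1 := by
  have hGt : Tendsto G (𝓝 0) (𝓝 x₀) := by
    rw [← hG0]
    exact hG
  have key : ∀ᶠ u in 𝓝 0, DifferentiableAt ℝ (fun u => ⟪Z u, Z u⟫) u ∧
      fderiv ℝ (fun u => ⟪Z u, Z u⟫) u e = 0 := by
    filter_upwards [hZe, hZ.eventually (by simp), hpZ, hGt.eventually hn] with u h1 h2 h3 ⟨c, h4⟩
    have h5 := (h2.differentiableAt two_ne_zero).hasFDerivAt
    have h6 : HasFDerivAt (fun u => ⟪Z u, Z u⟫) _ u := h5.inner ℝ h5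
    refine ⟨h6.differentiableAt, ?_⟩
    have h7 : ⟪Z u, p (G u)⟫ = 0 := by rw [real_inner_comm, h3]
    rw [h6.fderiv]
    simp [h1, h4, inner_smul_right, inner_smul_left, h3, h7]
  filter_upwards [eventually_eq_projAlong key, h0] with u h1 h2
  simp only [real_inner_self_eq_norm_sq, h2] at h1
  nlinarith [norm_nonneg (Z u)]

/-- Gauss lemma: the geodesics stay orthogonal to the images of the translated initial front. -/
lemma eventually_gauss {p n G Z : E → E} {f : E → ℝ} {α β : E → ℝ} {x₀ e : E} (he : ‖e‖ = 1)
    (hf : ∀ᶠ x in 𝓝 x₀, HasFDerivAt f (innerSL ℝ (p x)) x)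
    (hn : ∀ᶠ x in 𝓝 x₀, ∃ c : ℝ, n x = c • p x)
    (hG : ContDiffAt ℝ 2 G 0) (hZ : ContDiffAt ℝ 2 Z 0) (hG0 : G 0 = x₀)
    (hGe : ∀ᶠ u in 𝓝 0, fderiv ℝ G u e = Z u)
    (hZe : ∀ᶠ u in 𝓝 0, fderiv ℝ Z u e = -(⟪fderiv ℝ p (G u) (Z u), Z u⟫ • n (G u)))
    (hpZ : ∀ᶠ u in 𝓝 0, ⟪p (G u), Z u⟫ = 0) (hZ1 : ∀ᶠ u in 𝓝 0, ‖Z u‖ = 1)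
    (hGπ : ∀ᶠ u in 𝓝 0, G (projAlong e u) = parabola x₀ e (projAlong e u))
    (hZπ : ∀ᶠ w in 𝓝 0, Z (projAlong e w) = α (projAlong e w) • (e + projAlong e w) +
      β (projAlong e w) • p (G (projAlong e w))) :
    ∀ᶠ u in 𝓝 0, ∀ h, ⟪p (G u), fderiv ℝ G u h⟫ = 0 → ⟪fderiv ℝ G u h, Z u⟫ = ⟪e, h⟫ := by
  have hGt : Tendsto G (𝓝 0) (𝓝 x₀) := by
    rw [← hG0]
    exact hG.continuousAt
  have hπt := tendsto_projAlong_zero e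
  have hGd : ∀ᶠ u in 𝓝 0, HasFDerivAt G (fderiv ℝ G u) u :=
    (hG.eventually (by simp)).mono fun u hu => (hu.differentiableAt two_ne_zero).hasFDerivAt
  have hfG : ∀ᶠ u in 𝓝 0, HasFDerivAt (fun u => f (G u)) (innerSL ℝ (p (G u)) ∘L fderiv ℝ G u) u := by
    filter_upwards [hGd, hGt.eventually hf] with u h1 h2 using h2.comp u h1
  -- the level of `f` is constant along geodesics
  have hfGπ : ∀ᶠ u in 𝓝 0, f (G u) = f (G (projAlong e u)) := by
    refine eventually_eq_projAlong (g := fun u => f (G u)) ?_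
    filter_upwards [hfG, hGe, hpZ] with u h1 h2 h3
    exact ⟨h1.differentiableAt, by simp [h1.fderiv, h2, h3]⟩
  have hj : ∀ᶠ u in 𝓝 0, ∀ h, ⟪p (G u), fderiv ℝ G u h⟫ =
      ⟪p (G (projAlong e u)), fderiv ℝ G (projAlong e u) (projAlong e h)⟫ := by
    filter_upwards [hfGπ.eventually_nhds, hfG, hπt.eventually hfG] with u h1 h2 h3 h
    have h4 := (h3.comp u (projAlong e).hasFDerivAt).congr_of_eventuallyEq h1
    exact DFunLike.congr_fun (h2.unique h4) h
  -- the derivative on the initial front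
  have hGπd : ∀ᶠ u in 𝓝 0, ∀ h, fderiv ℝ G (projAlong e u) (projAlong e h) =
      projAlong e h - ⟪projAlong e u, projAlong e h⟫ • e := by
    filter_upwards [hGπ.eventually_nhds, hπt.eventually hGd] with u h1 h2 h
    have h3 := (h2.comp u (projAlong e).hasFDerivAt)
    have h4 := ((hasFDerivAt_parabola x₀ e (projAlong e u)).comp u
      (projAlong e).hasFDerivAt).congr_of_eventuallyEq h1
    have := DFunLike.congr_fun (h3.unique h4) h
    simpa using this
  -- the variation of the inner product along the geodesics
  have hvar : ∀ᶠ u in 𝓝 0, ∀ h, ⟪p (G u), fderiv ℝ G u h⟫ = 0 →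
      DifferentiableAt ℝ (fun u => ⟪fderiv ℝ G u h, Z u⟫) u ∧
      fderiv ℝ (fun u => ⟪fderiv ℝ G u h, Z u⟫) u e = 0 := by
    filter_upwards [hG.eventually (by simp), hZ.eventually (by simp), hGe.eventually_nhds, hZe,
      hZ1.eventually_nhds, hGt.eventually hn] with u h1 h2 h3 h4 h5 ⟨c, h6⟩ h hh
    have hZd := (h2.differentiableAt two_ne_zero).hasFDerivAt
    have hGd' : HasFDerivAt (fderiv ℝ G) (fderiv ℝ (fderiv ℝ G) u) u :=
      ((h1.fderiv_right (m := 1) le_rfl).differentiableAt one_ne_zero).hasFDerivAt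
    have h7 : HasFDerivAt (fun u => ⟪fderiv ℝ G u h, Z u⟫) _ u :=
      (hGd'.clm_apply (hasFDerivAt_const h u)).inner ℝ hZd
    have h8 : fderiv ℝ (fderiv ℝ G) u e h = fderiv ℝ Z u h := by
      rw [(h1.isSymmSndFDerivAt (by simp)) e h]
      have h9 := (hGd'.clm_apply (hasFDerivAt_const e u)).congr_of_eventuallyEq
        (h3.mono fun _ => Eq.symm)
      have := DFunLike.congr_fun (hZd.unique h9) h
      simpa using this.symm
    have h10 : ⟪fderiv ℝ Z u h, Z u⟫ = 0 := by
      have h11 : HasFDerivAt (fun u => ⟪Z u, Z u⟫) _ u := hZd.inner ℝ hZd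
      have h12 : (fun u => ⟪Z u, Z u⟫) =ᶠ[𝓝 u] fun _ => 1 :=
        h5.mono fun v hv => by simp [hv]
      have := DFunLike.congr_fun (h11.unique ((hasFDerivAt_const _ u).congr_of_eventuallyEq h12)) h
      simp [real_inner_comm (Z u)] at this
      rw [real_inner_comm, this]
    refine ⟨h7.differentiableAt, ?_⟩
    rw [h7.fderiv]
    simp [h8, h10, h4, h6, inner_smul_right, real_inner_comm (p (G u)), hh]
  filter_upwards [eventually_alongCurve e hj, eventually_alongCurve e hvar, hπt.eventually hZ1,
    hGπd, hj, hπt.eventually hGe, hZπ] with u h1 h2 h3 h4 h5 h6 h7 h hh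
  have h8 := eq_of_fderiv_along (g := fun u => ⟪fderiv ℝ G u h, Z u⟫) (u := u) (e := e)
    (fun t ht => h2 t ht h (by rw [h1 t ht, projAlong_alongCurve he, ← h5, hh])) 1 (by simp)
  simp only [alongCurve_one] at h8
  rw [h8]
  have h9 : h = projAlong e h + ⟪e, h⟫ • e := by simp [projAlong_apply]
  have h10 : ⟪fderiv ℝ G (projAlong e u) (projAlong e h), Z (projAlong e u)⟫ = 0 := by
    have h11 : ⟪fderiv ℝ G (projAlong e u) (projAlong e h), p (G (projAlong e u))⟫ = 0 := by
      rw [real_inner_comm, ← h5, hh]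
    rw [h7, inner_add_right, inner_smul_right, inner_smul_right, h11, h4]
    have h12 : ⟪projAlong e h, e⟫ = 0 := by rw [real_inner_comm, inner_projAlong he]
    rw [inner_sub_left, inner_add_right, inner_add_right, inner_smul_left, inner_smul_left, h12,
      inner_projAlong he, real_inner_self_eq_norm_sq, he, real_inner_comm (projAlong e u)]
    simp
  conv_lhs => rw [h9]
  rw [map_add, map_smul, inner_add_left, h10, h6, inner_smul_left, real_inner_self_eq_norm_sq, h3]
  simp

end Invariants

section NormalField

variable {E : Type*} [NormedAddCommGroup E] [InnerProductSpace ℝ E]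

lemma exists_local_inverse [CompleteSpace E] {G : E → E} {a : E} (hG : ContDiffAt ℝ 2 G a)
    (hG' : HasFDerivAt G (.id ℝ E) a) :
    ∃ Θ : E → E, ContDiffAt ℝ 2 Θ (G a) ∧ Θ (G a) = a ∧ HasFDerivAt Θ (.id ℝ E) (G a) ∧
      (∀ᶠ x in 𝓝 (G a), G (Θ x) = x) ∧ ∀ᶠ u in 𝓝 a, Θ (G u) = u := by
  have h1 : HasFDerivAt G ((ContinuousLinearEquiv.refl ℝ E : E ≃L[ℝ] E) : E →L[ℝ] E) a := hG'
  have h2 := hG.hasStrictFDerivAt' h1 two_ne_zero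
  exact ⟨hG.localInverse h1 two_ne_zero, hG.to_localInverse h1 two_ne_zero,
    hG.localInverse_apply_image h1 two_ne_zero, h2.to_localInverse.hasFDerivAt,
    h2.eventually_right_inverse, h2.eventually_left_inverse⟩

/-- A unit tangent field to the level sets of `f` which is dual, on these level sets, to the
differential of a function. -/
theorem exists_normal_field [FiniteDimensional ℝ E] {f : E → ℝ} {x₀ e : E}
    (hf : ContDiffAt ℝ 3 f x₀) (hf0 : fderiv ℝ f x₀ ≠ 0) (he : ‖e‖ = 1)
    (hfe : fderiv ℝ f x₀ e = 0) :
    ∃ (ξ : E → E) (s : E → ℝ), ContDiffAt ℝ 2 ξ x₀ ∧ ContDiffAt ℝ 2 s x₀ ∧ ξ x₀ = e ∧ s x₀ = 0 ∧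
      (∀ᶠ x in 𝓝 x₀, ‖ξ x‖ = 1 ∧ fderiv ℝ f x (ξ x) = 0 ∧
        ∀ k, fderiv ℝ f x k = 0 → fderiv ℝ s x k = ⟪ξ x, k⟫) ∧
      ∀ k, fderiv ℝ f x₀ k = 0 → ⟪k, fderiv ℝ ξ x₀ k⟫ = ‖projAlong e k‖ ^ 2 := by
  have := FiniteDimensional.complete ℝ E
  let p : E → E := fun x => (InnerProductSpace.toDual ℝ E).symm (fderiv ℝ f x)
  have hpf : ∀ x k, ⟪p x, k⟫ = fderiv ℝ f x k := fun x k => by simp [p]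
  have hp : ContDiffAt ℝ 2 p x₀ :=
    (InnerProductSpace.toDual ℝ E).symm.toContinuousLinearEquiv.contDiff.contDiffAt.comp x₀
      (hf.fderiv_right le_rfl)
  have hp0 : p x₀ ≠ 0 := by simpa [p] using hf0
  have hpe : ⟪p x₀, e⟫ = 0 := by rw [hpf, hfe]
  have hpp : ⟪p x₀, p x₀⟫ ≠ 0 := by simpa using hp0
  let n : E → E := fun x => (⟪p x, p x⟫)⁻¹ • p x
  have hn : ContDiffAt ℝ 2 n x₀ := ((hp.inner ℝ hp).inv hpp).smul hp
  have hpn : ∀ᶠ x in 𝓝 x₀, ⟪p x, n x⟫ = 1 := by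
    filter_upwards [(hp.inner ℝ hp).continuousAt.eventually_ne hpp] with x hx
    rw [inner_smul_right, inv_mul_cancel₀ hx]
  have hn' : ∀ᶠ x in 𝓝 x₀, ∃ c : ℝ, n x = c • p x := Eventually.of_forall fun x => ⟨_, rfl⟩
  obtain ⟨α, β, hα, hβ, hα0, hβ0, hαβ⟩ := exists_initial_direction hp hp0 he hpe
  let ζ : E → E := fun w => α w • (e + w) + β w • p (parabola x₀ e w)
  have hpσ : ContDiffAt ℝ 2 (fun w => p (parabola x₀ e w)) 0 :=
    ContDiffAt.comp (g := p) (f := parabola x₀ e) 0 (by rwa [parabola_zero])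
      (contDiff_parabola x₀ e).contDiffAt
  have hζ : ContDiffAt ℝ 2 ζ 0 :=
    (hα.smul (contDiffAt_const.add contDiffAt_id)).add (hβ.smul hpσ)
  have hζ0 : ζ 0 = e := by simp [ζ, hα0, hβ0]
  obtain ⟨G, Z, hG, hZ, hGe, hZe, hGZ⟩ := exists_geodesic_family hp hn he hζ hζ0
  have hG0 : G 0 = x₀ := by simpa [parabola_zero] using hGZ.self_of_nhds.1
  have hZ0 : Z 0 = e := by simpa [hζ0] using hGZ.self_of_nhds.2
  have hπt := tendsto_projAlong_zero e
  have hGπ : ∀ᶠ u in 𝓝 0, G (projAlong e u) = parabola x₀ e (projAlong e u) :=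
    hGZ.mono fun u hu => hu.1
  have hZπ : ∀ᶠ u in 𝓝 0, Z (projAlong e u) = α (projAlong e u) • (e + projAlong e u) +
      β (projAlong e u) • p (G (projAlong e u)) := by
    filter_upwards [hGZ] with u hu
    rw [hu.1, hu.2]
  have hpZ := eventually_orthogonal_of_geodesic hp hpn hG hZ hG0 hGe hZe (by
    filter_upwards [hGZ, hπt.eventually hαβ] with u h1 h2
    rw [h1.1, h1.2, h2.2])
  have hZ1 := eventually_norm_eq_one_of_geodesic hG.continuousAt hG0 hZ hn' hZe hpZ (by
    filter_upwards [hGZ, hπt.eventually hαβ] with u h1 h2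
    rw [h1.2, h2.1])
  have hfd : ∀ᶠ x in 𝓝 x₀, HasFDerivAt f (innerSL ℝ (p x)) x := by
    filter_upwards [hf.eventually (by simp)] with x hx
    exact (hx.differentiableAt three_ne_zero).hasFDerivAt.congr_fderiv (by ext k; simp [hpf])
  have hgauss := eventually_gauss he hfd hn' hG hZ hG0 hGe hZe hpZ hZ1 hGπ hZπ
  have hGd0 := (hG.differentiableAt two_ne_zero).hasFDerivAt
  have hZd0 := (hZ.differentiableAt two_ne_zero).hasFDerivAt
  have hdec : ∀ k, k = projAlong e k + ⟪e, k⟫ • e := fun k => by simp [projAlong_apply]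
  -- derivatives at the base point
  have hDG : HasFDerivAt G (.id ℝ E) 0 := by
    refine hGd0.congr_fderiv (ContinuousLinearMap.ext fun k => ?_)
    have h1 : fderiv ℝ G 0 (projAlong e k) = projAlong e k := by
      have h2 : HasFDerivAt (fun u => G (projAlong e u)) (fderiv ℝ G 0 ∘L projAlong e) 0 :=
        HasFDerivAt.comp (g := G) 0 (by rwa [map_zero]) (projAlong e).hasFDerivAt
      have h3 := ((hasFDerivAt_parabola x₀ e (projAlong e 0)).comp 0
        (projAlong e).hasFDerivAt).congr_of_eventuallyEq hGπ
      have := DFunLike.congr_fun (h2.unique h3) k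
      simpa using this
    have h4 := hGe.self_of_nhds
    rw [hZ0] at h4
    conv_lhs => rw [hdec k]
    rw [map_add, map_smul, h1, h4, ← hdec k]
    rfl
  have hDZ : ∀ w, ⟪e, w⟫ = 0 → ⟪p x₀, w⟫ = 0 → ⟪w, fderiv ℝ Z 0 w⟫ = ‖w‖ ^ 2 := by
    intro w hew hpw
    have h2 : HasFDerivAt (fun u => Z (projAlong e u)) (fderiv ℝ Z 0 ∘L projAlong e) 0 :=
      HasFDerivAt.comp (g := Z) 0 (by rwa [map_zero]) (projAlong e).hasFDerivAt
    have h3 : HasFDerivAt ζ _ 0 := ((hα.differentiableAt two_ne_zero).hasFDerivAt.smul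
      ((hasFDerivAt_id (0 : E)).const_add e)).add
      ((hβ.differentiableAt two_ne_zero).hasFDerivAt.smul
        (hpσ.differentiableAt two_ne_zero).hasFDerivAt)
    have h4 := (HasFDerivAt.comp (g := ζ) (f := projAlong e) 0 (by rw [map_zero]; exact h3)
        (projAlong e).hasFDerivAt).congr_of_eventuallyEq (hGZ.mono fun u hu => hu.2)
    have := DFunLike.congr_fun (h2.unique h4) w
    simp [projAlong_of_inner_eq_zero hew, hα0, hβ0, parabola_zero] at this
    rw [this]
    simp [inner_add_right, inner_smul_right, real_inner_comm e, hew, real_inner_comm (p x₀), hpw]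
  obtain ⟨Θ, hΘ, hΘ0, hDΘ, hGΘ, -⟩ := exists_local_inverse hG hDG
  rw [hG0] at hΘ hΘ0 hDΘ hGΘ
  have hΘt : Tendsto Θ (𝓝 x₀) (𝓝 0) := by
    rw [← hΘ0]
    exact hΘ.continuousAt
  have hξ : ContDiffAt ℝ 2 (fun x => Z (Θ x)) x₀ :=
    ContDiffAt.comp (g := Z) x₀ (by rwa [hΘ0]) hΘ
  have hξ1 : ∀ᶠ x in 𝓝 x₀, ‖Z (Θ x)‖ = 1 := hΘt.eventually hZ1
  refine ⟨fun x => Z (Θ x), fun x => ⟪e, Θ x⟫, hξ, contDiffAt_const.inner ℝ hΘ, by simp [hΘ0, hZ0],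
    by simp [hΘ0], ?_, ?_⟩
  · filter_upwards [hξ1, hΘt.eventually hpZ, hGΘ.eventually_nhds, hΘt.eventually hgauss,
      hΘ.eventually (by simp), hΘt.eventually (hG.eventually (by simp))] with x h1 h2 h3 h4 h5 h6
    have h7 := (h5.differentiableAt two_ne_zero).hasFDerivAt
    refine ⟨h1, ?_, fun k hk => ?_⟩
    · rw [h3.self_of_nhds] at h2
      rw [← hpf, h2]
    · have h8 : HasFDerivAt (fun x => ⟪e, Θ x⟫) (innerSL ℝ e ∘L fderiv ℝ Θ x) x :=
        (innerSL ℝ e).hasFDerivAt.comp x h7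
      have h9 := (h6.differentiableAt two_ne_zero).hasFDerivAt.comp x h7
      have h10 := DFunLike.congr_fun (h9.unique ((hasFDerivAt_id x).congr_of_eventuallyEq h3)) k
      have h11 : fderiv ℝ G (Θ x) (fderiv ℝ Θ x k) = k := h10
      have h12 := h4 (fderiv ℝ Θ x k) (by rw [h11, h3.self_of_nhds, hpf, hk])
      rw [h11] at h12
      rw [h8.fderiv, real_inner_comm, h12]
      rfl
  · intro k hk
    have h1 : HasFDerivAt (fun x => Z (Θ x)) (fderiv ℝ Z 0) x₀ := by
      have := HasFDerivAt.comp (g := Z) (f := Θ) (g' := fderiv ℝ Z 0) x₀ (by rwa [hΘ0]) hDΘ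
      exact this
    have h2 : ⟪e, fderiv ℝ Z 0 k⟫ = 0 := by
      have h11 : HasFDerivAt (fun x => ⟪Z (Θ x), Z (Θ x)⟫) _ x₀ := h1.inner ℝ h1
      have h12 : (fun x => ⟪Z (Θ x), Z (Θ x)⟫) =ᶠ[𝓝 x₀] fun _ => 1 :=
        hξ1.mono fun v hv => by simp [hv]
      have := DFunLike.congr_fun
        (h11.unique ((hasFDerivAt_const _ x₀).congr_of_eventuallyEq h12)) k
      simp [real_inner_comm e, hΘ0, hZ0] at this
      exact this
    have h3 : ⟪p x₀, projAlong e k⟫ = 0 := by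
      rw [projAlong_apply, inner_sub_right, inner_smul_right, hpe, hpf, hk]
      simp
    have h4 : ⟪projAlong e k, fderiv ℝ Z 0 e⟫ = 0 := by
      rw [hZe.self_of_nhds, hG0, inner_neg_right, inner_smul_right, inner_smul_right,
        real_inner_comm (p x₀) (projAlong e k), h3]
      simp
    rw [h1.fderiv]
    have h5 : fderiv ℝ Z 0 k = fderiv ℝ Z 0 (projAlong e k) + ⟪e, k⟫ • fderiv ℝ Z 0 e := by
      rw [← map_smul, ← map_add, ← hdec k]
    have h6 : ⟪k, fderiv ℝ Z 0 k⟫ = ⟪projAlong e k, fderiv ℝ Z 0 k⟫ := by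
      rw [projAlong_apply, inner_sub_left, real_inner_smul_left, h2, mul_zero, sub_zero]
    rw [h6, h5, inner_add_right, inner_smul_right, h4, mul_zero, add_zero,
      hDZ _ (inner_projAlong he k) h3]

end NormalField

section Convexity

variable {E : Type*} [NormedAddCommGroup E] [InnerProductSpace ℝ E]

lemma exists_pos_mul_sq_le_inner [FiniteDimensional ℝ E] {A B : E →L[ℝ] E} {ℓ : E →L[ℝ] ℝ}
    (h : ∀ k, ℓ k = 0 → k ≠ 0 → 0 < ⟪A k, B k⟫) :
    ∃ c > 0, ∀ k, ℓ k = 0 → c * ‖k‖ ^ 2 ≤ ⟪A k, B k⟫ := by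
  have := FiniteDimensional.proper_real E
  let S : Set E := sphere 0 1 ∩ {k | ℓ k = 0}
  have hS : IsCompact S :=
    (isCompact_sphere 0 1).inter_right (isClosed_eq ℓ.continuous continuous_const)
  have hne : ∀ k ∈ S, k ≠ 0 := by
    rintro k ⟨h1, -⟩ rfl
    simp at h1
  obtain ⟨c, hc, hcS⟩ : ∃ c > 0, ∀ k ∈ S, c ≤ ⟪A k, B k⟫ := by
    rcases S.eq_empty_or_nonempty with h0 | h0
    · exact ⟨1, one_pos, by simp [h0]⟩
    · obtain ⟨k, hk, hmin⟩ := hS.exists_isMinOn h0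
        (f := fun k => ⟪A k, B k⟫) (A.continuous.inner B.continuous).continuousOn
      exact ⟨_, h k hk.2 (hne k hk), fun k' hk' => hmin hk'⟩
  refine ⟨c, hc, fun k hk => ?_⟩
  rcases eq_or_ne k 0 with rfl | h0
  · simp
  have hk0 : ‖k‖ ≠ 0 := by simpa using h0
  have h1 := hcS (‖k‖⁻¹ • k) ⟨by simp [norm_smul, hk0], by simp [hk]⟩
  rw [map_smul, map_smul, real_inner_smul_left, real_inner_smul_right] at h1
  have h2 := mul_le_mul_of_nonneg_right h1 (sq_nonneg ‖k‖)
  calc c * ‖k‖ ^ 2 ≤ _ := h2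
    _ = ⟪A k, B k⟫ := by field_simp

/-- The hypersurface parametrized by `y` in the coordinates of a flat chart lies locally on one
side of its tangent hyperplanes. -/
lemma exists_ball_inner_sub_neg [FiniteDimensional ℝ E] {y ξ : E → E} {ℓ : E →L[ℝ] ℝ}
    (hy : ContDiffAt ℝ 2 y 0) (hξ : ContDiffAt ℝ 2 ξ 0)
    (horth : ∀ᶠ z in 𝓝 0, ∀ k, ℓ k = 0 → ⟪fderiv ℝ y z k, ξ z⟫ = 0)
    (hpos : ∀ k, ℓ k = 0 → k ≠ 0 → 0 < ⟪fderiv ℝ y 0 k, fderiv ℝ ξ 0 k⟫) :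
    ∃ r > 0, ∀ z ∈ ball 0 r, ∀ z' ∈ ball 0 r, ℓ (z' - z) = 0 → z' ≠ z →
      ⟪y z' - y z, ξ z⟫ < 0 := by
  obtain ⟨c, hc, hcA⟩ := exists_pos_mul_sq_le_inner hpos
  set A := fderiv ℝ y 0
  set B := fderiv ℝ ξ 0
  obtain ⟨η, hη, hηc⟩ : ∃ η > 0, η * ‖B‖ + (‖A‖ + η) * η < c := by
    have h1 : Tendsto (fun η : ℝ => η * ‖B‖ + (‖A‖ + η) * η) (𝓝 0) (𝓝 0) :=
      Continuous.tendsto' (by fun_prop) 0 0 (by simp)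
    obtain ⟨η, h2, h3⟩ := ((h1.eventually_lt_const hc).filter_mono
      nhdsWithin_le_nhds |>.and (self_mem_nhdsWithin (s := Ioi (0 : ℝ)))).exists
    exact ⟨η, h3, h2⟩
  have hyA : ∀ᶠ z in 𝓝 0, ‖fderiv ℝ y z - A‖ < η := by
    have h1 : ContinuousAt (fun z => ‖fderiv ℝ y z - A‖) 0 :=
      ((hy.fderiv_right (m := 1) le_rfl).continuousAt.sub continuousAt_const).norm
    exact h1.eventually_lt_const (by simpa [A] using hη)
  have hξB : ∀ᶠ q : E × E in 𝓝 (0, 0), ‖ξ q.1 - ξ q.2 - B (q.1 - q.2)‖ ≤ η * ‖q.1 - q.2‖ :=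
    (hξ.hasStrictFDerivAt two_ne_zero).isLittleO.def hη
  rw [nhds_prod_eq, eventually_prod_iff] at hξB
  obtain ⟨P, hP, P', hP', hPP'⟩ := hξB
  obtain ⟨r, hr, hball⟩ := Metric.eventually_nhds_iff_ball.1
    ((((hP.and hP').and horth).and hyA).and (hy.eventually (by simp)))
  refine ⟨r, hr, fun z hz z' hz' hℓ hne => ?_⟩
  have he0 : z' - z ≠ 0 := sub_ne_zero.2 hne
  have hmem : ∀ t ∈ Icc (0 : ℝ) 1, z + t • (z' - z) ∈ ball (0 : E) r := fun t ht =>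
    (convex_ball (0 : E) r).add_smul_sub_mem hz hz' ht
  have hd : ∀ t ∈ Icc (0 : ℝ) 1, HasDerivAt (fun t : ℝ => ⟪y (z + t • (z' - z)) - y z, ξ z⟫)
      ⟪fderiv ℝ y (z + t • (z' - z)) (z' - z), ξ z⟫ t := by
    intro t ht
    have h1 : HasDerivAt (fun t : ℝ => z + t • (z' - z)) (z' - z) t := by
      simpa using ((hasDerivAt_id t).smul_const (z' - z)).const_add z
    have h2 := ((hball _ (hmem t ht)).2.differentiableAt two_ne_zero).hasFDerivAt.comp_hasDerivAt
      t h1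
    simpa using (h2.sub_const (y z)).inner ℝ (hasDerivAt_const t (ξ z))
  have hneg : ∀ t ∈ Ioo (0 : ℝ) 1, ⟪fderiv ℝ y (z + t • (z' - z)) (z' - z), ξ z⟫ < 0 := by
    intro t ht
    set e := z' - z
    obtain ⟨⟨⟨⟨h1, -⟩, h2⟩, h3⟩, -⟩ := hball _ (hmem t (Ioo_subset_Icc_self ht))
    set w := z + t • e
    have h4 := hPP' h1 (hball z hz).1.1.1.2
    have hwz : w - z = t • e := by simp [w]
    simp only [hwz, map_smul] at h4
    rw [norm_smul, Real.norm_of_nonneg ht.1.le] at h4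
    have he : 0 < ‖e‖ := norm_pos_iff.2 he0
    have h5 : ‖fderiv ℝ y w e - A e‖ ≤ η * ‖e‖ := by
      simpa using (fderiv ℝ y w - A).le_of_opNorm_le h3.le e
    have h6 : ‖fderiv ℝ y w e‖ ≤ (‖A‖ + η) * ‖e‖ := by
      calc ‖fderiv ℝ y w e‖ = ‖A e + (fderiv ℝ y w e - A e)‖ := by rw [add_sub_cancel]
        _ ≤ ‖A e‖ + ‖fderiv ℝ y w e - A e‖ := norm_add_le _ _
        _ ≤ ‖A‖ * ‖e‖ + η * ‖e‖ := add_le_add (A.le_opNorm e) h5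
        _ = (‖A‖ + η) * ‖e‖ := by ring
    have h7 : |⟪fderiv ℝ y w e - A e, B e⟫| ≤ η * ‖e‖ * (‖B‖ * ‖e‖) :=
      (abs_real_inner_le_norm _ _).trans (mul_le_mul h5 (B.le_opNorm e) (norm_nonneg _)
        (by positivity))
    have h8 : |⟪fderiv ℝ y w e, ξ w - ξ z - t • B e⟫| ≤ (‖A‖ + η) * ‖e‖ * (η * (t * ‖e‖)) :=
      (abs_real_inner_le_norm _ _).trans (mul_le_mul h6 h4 (norm_nonneg _) (by positivity))
    have h9 : ⟪fderiv ℝ y w e, ξ z⟫ = -(t * ⟪A e, B e⟫ + t * ⟪fderiv ℝ y w e - A e, B e⟫ +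
        ⟪fderiv ℝ y w e, ξ w - ξ z - t • B e⟫) := by
      simp only [inner_sub_left, inner_sub_right, real_inner_smul_right, h2 e hℓ]
      ring
    have h10 := mul_le_mul_of_nonneg_left (hcA e hℓ) ht.1.le
    have h11 := mul_le_mul_of_nonneg_left (abs_le.1 h7).1 ht.1.le
    have h12 : 0 < t * ‖e‖ ^ 2 * (c - (η * ‖B‖ + (‖A‖ + η) * η)) :=
      mul_pos (mul_pos ht.1 (by positivity)) (sub_pos.2 hηc)
    rw [h9]
    linarith [(abs_le.1 h8).1]
  have hanti := strictAntiOn_of_deriv_neg (convex_Icc (0 : ℝ) 1)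
    (fun t ht => (hd t ht).continuousAt.continuousWithinAt) (fun t ht => by
      rw [interior_Icc] at ht
      rw [(hd t (Ioo_subset_Icc_self ht)).deriv]
      exact hneg t ht)
  simpa using hanti (by simp) (by simp) one_pos

/-- Strict convexity of a front over a level set of `f`. -/
theorem exists_mem_nhds_inner_sub_neg [FiniteDimensional ℝ E] {y ξ : E → E} {f : E → ℝ} {x₀ : E}
    (hf : ContDiffAt ℝ 2 f x₀) (hf0 : fderiv ℝ f x₀ ≠ 0)
    (hy : ContDiffAt ℝ 2 y x₀) (hξ : ContDiffAt ℝ 2 ξ x₀)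
    (horth : ∀ᶠ x in 𝓝 x₀, ∀ k, fderiv ℝ f x k = 0 → ⟪fderiv ℝ y x k, ξ x⟫ = 0)
    (hpos : ∀ k, fderiv ℝ f x₀ k = 0 → k ≠ 0 → 0 < ⟪fderiv ℝ y x₀ k, fderiv ℝ ξ x₀ k⟫) :
    ∃ W ∈ 𝓝 x₀, ∀ x ∈ W, ∀ x' ∈ W, f x' = f x → x' ≠ x → ⟪y x' - y x, ξ x⟫ < 0 := by
  have := FiniteDimensional.complete ℝ E
  set ℓ := fderiv ℝ f x₀ with hℓ
  obtain ⟨m, hm⟩ : ∃ m, ℓ m = 1 := by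
    obtain ⟨v, hv⟩ := DFunLike.ne_iff.1 hf0
    exact ⟨(ℓ v)⁻¹ • v, by rw [map_smul, smul_eq_mul, inv_mul_cancel₀ hv]⟩
  let χ : E → E := fun x => x - x₀ + (f x - f x₀ - ℓ (x - x₀)) • m
  have hχ : ContDiffAt ℝ 2 χ x₀ := by
    have h1 : ContDiffAt ℝ 2 (fun x => x - x₀) x₀ := contDiffAt_id.sub contDiffAt_const
    exact h1.add (((hf.sub contDiffAt_const).sub (ℓ.contDiff.contDiffAt.comp x₀ h1)).smul
      contDiffAt_const)
  have hfd := (hf.differentiableAt two_ne_zero).hasFDerivAt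
  have hχd : HasFDerivAt χ (.id ℝ E) x₀ := by
    have h1 : HasFDerivAt (fun x => x - x₀) (.id ℝ E) x₀ := (hasFDerivAt_id x₀).sub_const x₀
    have h2 : HasFDerivAt (fun x => ℓ (x - x₀)) (ℓ ∘L .id ℝ E) x₀ := ℓ.hasFDerivAt.comp x₀ h1
    refine (h1.add (((hfd.sub_const (f x₀)).sub h2).smul_const m)).congr_fderiv ?_
    ext k
    simp [hℓ]
  have hχ0 : χ x₀ = 0 := by simp [χ]
  have hℓχ : ∀ x, ℓ (χ x) = f x - f x₀ := fun x => by simp [χ, hm]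
  obtain ⟨κ, hκ, hκ0, hκd, hχκ, hκχ⟩ := exists_local_inverse hχ hχd
  rw [hχ0] at hκ hκ0 hκd hχκ
  have hκt : Tendsto κ (𝓝 0) (𝓝 x₀) := by
    rw [← hκ0]
    exact hκ.continuousAt
  have hcomp : ∀ {g : E → E}, ContDiffAt ℝ 2 g x₀ →
      ContDiffAt ℝ 2 (fun z => g (κ z)) 0 ∧ fderiv ℝ (fun z => g (κ z)) 0 = fderiv ℝ g x₀ := by
    intro g hg
    refine ⟨ContDiffAt.comp (g := g) 0 (by rwa [hκ0]) hκ, ?_⟩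
    have h1 := HasFDerivAt.comp (g := g) (f := κ) (g' := fderiv ℝ g x₀) 0
      (by rw [hκ0]; exact (hg.differentiableAt two_ne_zero).hasFDerivAt) hκd
    exact h1.fderiv
  obtain ⟨r, hr, hball⟩ := exists_ball_inner_sub_neg (ℓ := ℓ) (hcomp hy).1 (hcomp hξ).1 (by
    filter_upwards [hκt.eventually horth, hκt.eventually (hy.eventually (by simp)),
      hκt.eventually (hf.eventually (by simp)), hκ.eventually (by simp),
      hχκ.eventually_nhds] with z h1 h2 h3 h4 h5 k hk
    have h6 := (h4.differentiableAt two_ne_zero).hasFDerivAt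
    have h7 := (h2.differentiableAt two_ne_zero).hasFDerivAt.comp z h6
    have h8 := (h3.differentiableAt two_ne_zero).hasFDerivAt.comp z h6
    have h9 : HasFDerivAt (fun z => f x₀ + ℓ z) ℓ z := ℓ.hasFDerivAt.const_add _
    have h10 : (fun z => f (κ z)) =ᶠ[𝓝 z] fun z => f x₀ + ℓ z := by
      filter_upwards [h5] with v hv
      rw [← hv, hℓχ, hv]
      ring
    have h11 := DFunLike.congr_fun (h8.unique (h9.congr_of_eventuallyEq h10)) k
    have h12 := h1 (fderiv ℝ κ z k) (h11.trans hk)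
    have h13 : fderiv ℝ (fun z => y (κ z)) z k = fderiv ℝ y (κ z) (fderiv ℝ κ z k) := by
      have := h7.fderiv
      exact DFunLike.congr_fun this k
    rw [h13, h12]) (by rwa [(hcomp hy).2, (hcomp hξ).2])
  refine ⟨{x | κ (χ x) = x ∧ χ x ∈ ball 0 r}, ?_, ?_⟩
  · exact hκχ.and (hχ.continuousAt.eventually_mem (by rw [hχ0]; exact ball_mem_nhds 0 hr))
  · rintro x ⟨h1, h2⟩ x' ⟨h1', h2'⟩ hfx hne
    have := hball _ h2 _ h2' (by rw [map_sub, hℓχ, hℓχ, hfx, sub_self]) fun h => hne (by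
      rw [← h1', h, h1])
    rwa [h1, h1'] at this

end Convexity

section Front

variable {E : Type*} [NormedAddCommGroup E] [InnerProductSpace ℝ E]

lemma fderiv_apply_ne_zero_of_tangent {f : E → ℝ} {ξ : E → E} {x₀ e : E}
    (hf : ContDiffAt ℝ 3 f x₀) (hξ : ContDiffAt ℝ 2 ξ x₀) (hξ0 : ξ x₀ = e)
    (hfξ : ∀ᶠ x in 𝓝 x₀, fderiv ℝ f x (ξ x) = 0)
    (hcurv : fderiv ℝ (fun x => fderiv ℝ f x e) x₀ e ≠ 0) : fderiv ℝ ξ x₀ e ≠ 0 := by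
  intro h0
  have h1 : HasFDerivAt (fderiv ℝ f) (fderiv ℝ (fderiv ℝ f) x₀) x₀ :=
    ((hf.fderiv_right (m := 2) le_rfl).differentiableAt two_ne_zero).hasFDerivAt
  have h2 := h1.clm_apply (hξ.differentiableAt two_ne_zero).hasFDerivAt
  have h3 := DFunLike.congr_fun (h2.unique ((hasFDerivAt_const 0 x₀).congr_of_eventuallyEq hfξ)) e
  have h4 := h1.clm_apply (hasFDerivAt_const e x₀)
  rw [h4.fderiv] at hcurv
  simp [h0, hξ0] at h3 hcurv
  exact hcurv h3

theorem exists_convex_front [FiniteDimensional ℝ E] {f : E → ℝ} {x₀ e : E}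
    (hf : ContDiffAt ℝ 3 f x₀) (hf0 : fderiv ℝ f x₀ ≠ 0) (he : ‖e‖ = 1)
    (hfe : fderiv ℝ f x₀ e = 0) (hcurv : fderiv ℝ (fun x => fderiv ℝ f x e) x₀ e ≠ 0)
    {ε : ℝ} (hε : 0 < ε) :
    ∃ (ξ : E → E) (τ : E → ℝ) (W : Set E), IsOpen W ∧ x₀ ∈ W ∧ ContDiffOn ℝ 2 ξ W ∧
      ContDiffOn ℝ 2 τ W ∧ ξ x₀ = e ∧
      (∀ x ∈ W, ‖ξ x‖ = 1 ∧ fderiv ℝ f x (ξ x) = 0 ∧ τ x ∈ Icc (ε / 4) ε) ∧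
      ∀ x ∈ W, ∀ x' ∈ W, f x' = f x → x' ≠ x →
        ⟪(x' + τ x' • ξ x') - (x + τ x • ξ x), ξ x⟫ < 0 := by
  obtain ⟨ξ, s, hξ, hs, hξ0, hs0, hev, hpos⟩ := exists_normal_field hf hf0 he hfe
  let τ : E → ℝ := fun x => ε / 2 - s x
  have hτ : ContDiffAt ℝ 2 τ x₀ := contDiffAt_const.sub hs
  have hτ0 : τ x₀ = ε / 2 := by simp [τ, hs0]
  have hy : ContDiffAt ℝ 2 (fun x => x + τ x • ξ x) x₀ := contDiffAt_id.add (hτ.smul hξ)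
  have hyd : ∀ᶠ x in 𝓝 x₀, ∀ k, fderiv ℝ (fun x => x + τ x • ξ x) x k =
      k + (τ x • fderiv ℝ ξ x k - fderiv ℝ s x k • ξ x) := by
    filter_upwards [hξ.eventually (by simp), hs.eventually (by simp)] with x h1 h2 k
    have h3 : HasFDerivAt τ (-fderiv ℝ s x) x :=
      (h2.differentiableAt two_ne_zero).hasFDerivAt.const_sub (ε / 2)
    have h4 := (hasFDerivAt_id x).add (h3.smul (h1.differentiableAt two_ne_zero).hasFDerivAt)
    have h5 : fderiv ℝ (fun x => x + τ x • ξ x) x = _ := h4.fderiv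
    rw [h5]
    simp
    module
  have hξd : ∀ᶠ x in 𝓝 x₀, ∀ k, ⟪fderiv ℝ ξ x k, ξ x⟫ = 0 := by
    filter_upwards [hξ.eventually (by simp), hev.eventually_nhds] with x h1 h2 k
    have h3 := (h1.differentiableAt two_ne_zero).hasFDerivAt
    have h4 : HasFDerivAt (fun x => ⟪ξ x, ξ x⟫) _ x := h3.inner ℝ h3
    have h5 : (fun x => ⟪ξ x, ξ x⟫) =ᶠ[𝓝 x] fun _ => 1 := h2.mono fun v hv => by simp [hv.1]
    have h6 := DFunLike.congr_fun
      (h4.unique ((hasFDerivAt_const _ x).congr_of_eventuallyEq h5)) k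
    simpa [real_inner_comm (ξ x)] using h6
  have hξe := fderiv_apply_ne_zero_of_tangent hf hξ hξ0 (hev.mono fun x hx => hx.2.1) hcurv
  obtain ⟨W, hW, hWneg⟩ := exists_mem_nhds_inner_sub_neg (hf.of_le (by norm_num)) hf0 hy hξ (by
    filter_upwards [hyd, hξd, hev] with x h1 h2 h3 k hk
    rw [h1, h3.2.2 k hk]
    simp only [inner_add_left, inner_sub_left, real_inner_smul_left, h2,
      real_inner_self_eq_norm_sq, h3.1, real_inner_comm (ξ x) k]
    ring) (by
    intro k hk hk0
    have h1 : ⟪ξ x₀, fderiv ℝ ξ x₀ k⟫ = 0 := by rw [real_inner_comm, hξd.self_of_nhds]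
    rw [hyd.self_of_nhds, inner_add_left, inner_sub_left, real_inner_smul_left,
      real_inner_smul_left, h1, hpos k hk, hτ0, real_inner_self_eq_norm_sq, mul_zero, sub_zero]
    by_cases h2 : projAlong e k = 0
    · have h3 : k = ⟪e, k⟫ • e := by rwa [projAlong_apply, sub_eq_zero] at h2
      have h4 : fderiv ℝ ξ x₀ k ≠ 0 := by
        rw [h3, map_smul]
        refine smul_ne_zero (fun h5 => hk0 ?_) hξe
        rw [h3, h5, zero_smul]
      have := norm_pos_iff.2 h4
      positivity
    · have := norm_pos_iff.2 h2
      positivity)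
  have hτI : ∀ᶠ x in 𝓝 x₀, τ x ∈ Icc (ε / 4) ε :=
    hτ.continuousAt.eventually_mem (by
      rw [hτ0]
      exact Icc_mem_nhds (by linarith) (by linarith))
  obtain ⟨W', hW', hWo, hxW⟩ := _root_.mem_nhds_iff.1 ((((hev.and hτI).and (hξ.eventually
    (by simp))).and (hs.eventually (by simp))).and hW)
  refine ⟨ξ, τ, W', hWo, hxW, fun x hx => (hW' hx).1.1.2.contDiffWithinAt,
    fun x hx => (contDiffAt_const.sub (hW' hx).1.2).contDiffWithinAt, hξ0, fun x hx => ?_,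
    fun x hx x' hx' => hWneg x (hW' hx).2 x' (hW' hx').2⟩
  obtain ⟨⟨⟨⟨h1, h2⟩, -⟩, -⟩, -⟩ := hW' hx
  exact ⟨h1.1, h1.2.1, h2⟩

end Front

end Helpers

/-- Let `X` be a `C³` hypersurface in `ℝ^d`, locally given near `x₀ ∈ X`
as the regular zero set of a `C³` function `f` on an open set `U`, so that the tangent
space at `x ∈ X ∩ U` is `ker (fderiv ℝ f x)`. Let `ξ₀ ∈ T_{x₀}X` be a unit vector whose
normal curvature is non-zero, i.e. the second derivative of the defining function in the
direction `ξ₀` does not vanish. Then for every `ε > 0` there exist a relatively open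
neighbourhood `V` of `x₀` in `X`, a `C²` unit tangent field `ξ` on `V` with `ξ x₀ = ξ₀`,
and a `C²` function `τ : V → [δ, ε]` (`δ > 0`) such that the hypersurface
`Y = {x + τ(x) • ξ(x) : x ∈ V}` is strictly convex with outward unit normal
`ν_Y(x + τ(x) • ξ(x)) = ξ(x)`: each point of `Y` other than `y(x)` lies strictly in the
open half-space `{y : ⟨y - y(x), ξ(x)⟩ < 0}`, and the line through `y(x)` with direction
`ξ(x)` is tangent to `X` at `x`. -/
theorem convex_front_with_prescribed_tangent_normals
    {d : ℕ} (hd : 2 ≤ d)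
    (X : Set (Euc d)) (hX : IsSubmanifold 3 (d - 1) X)
    (x₀ : Euc d) (hx₀ : x₀ ∈ X)
    (U : Set (Euc d)) (hU : IsOpen U) (hx₀U : x₀ ∈ U)
    (f : Euc d → ℝ) (hf : ContDiffOn ℝ 3 f U)
    (hXU : X ∩ U = {x ∈ U | f x = 0})
    (hreg : ∀ x ∈ X ∩ U, fderiv ℝ f x ≠ 0)
    (ξ₀ : Euc d) (hξ₀unit : ‖ξ₀‖ = 1)
    (hξ₀tan : fderiv ℝ f x₀ ξ₀ = 0)
    (hcurv : fderiv ℝ (fun x => fderiv ℝ f x ξ₀) x₀ ξ₀ ≠ 0) :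
    ∀ ε > 0, ∃ (V : Set (Euc d)) (ξ : Euc d → Euc d) (τ : Euc d → ℝ) (δ : ℝ),
      0 < δ ∧ δ ≤ ε ∧
      x₀ ∈ V ∧ V ⊆ X ∩ U ∧ (∃ W, IsOpen W ∧ V = X ∩ W) ∧
      ContDiffOn ℝ 2 ξ V ∧ ContDiffOn ℝ 2 τ V ∧
      ξ x₀ = ξ₀ ∧
      (∀ x ∈ V, ‖ξ x‖ = 1 ∧ fderiv ℝ f x (ξ x) = 0 ∧ τ x ∈ Icc δ ε) ∧
      (∀ x ∈ V, ∀ x' ∈ V, x' ≠ x →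
        ⟪(x' + τ x' • ξ x') - (x + τ x • ξ x), ξ x⟫ < 0) := by
  intro ε hε
  have hmem : ∀ x ∈ X ∩ U, f x = 0 := fun x hx => by
    rw [hXU] at hx
    exact hx.2
  obtain ⟨ξ, τ, W, hW, hxW, hξ, hτ, hξ0, h1, h2⟩ := exists_convex_front
    (hf.contDiffAt (hU.mem_nhds hx₀U)) (hreg x₀ ⟨hx₀, hx₀U⟩) hξ₀unit hξ₀tan hcurv hε
  have hVW : X ∩ (W ∩ U) ⊆ W := fun x hx => hx.2.1
  have hVU : X ∩ (W ∩ U) ⊆ X ∩ U := fun x hx => ⟨hx.1, hx.2.2⟩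
  refine ⟨X ∩ (W ∩ U), ξ, τ, ε / 4, by positivity, by linarith, ⟨hx₀, hxW, hx₀U⟩, hVU,
    ⟨_, hW.inter hU, rfl⟩, hξ.mono hVW, hτ.mono hVW, hξ0, fun x hx => h1 x (hVW hx),
    fun x hx x' hx' => h2 x (hVW hx) x' (hVW hx') ?_⟩
  rw [hmem x (hVU hx), hmem x' (hVU hx')]
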